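/- Let p₁(x),…,pₙ(x) ∈ ℂ[x] be polynomials such that the Wronskian Wr(p₁,…,pₙ) is a nonzero polynomial all of whose complex roots are real. Then the ℂ-linear span of {p₁,…,pₙ} inside ℂ[x] has a real basis. -/

import Mathlib

/-- Right translation by `π`, acting on functions on the symmetric group. -/
def permShift (R : Type*) [CommRing R] {ι : Type*} (π : Equiv.Perm ι) :
    Module.End R (Equiv.Perm ι → R) :=
  LinearMap.funLeft R R (· * π)

theorem permShift_apply {R : Type*} [CommRing R] {ι : Type*} (π : Equiv.Perm ι)
    (ψ : Equiv.Perm ι → R) (σ : Equiv.Perm ι) : permShift R π ψ σ = ψ (σ * π) := rfl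

theorem permShift_mul {R : Type*} [CommRing R] {ι : Type*} (π ρ : Equiv.Perm ι) :
    permShift R π * permShift R ρ = permShift R (π * ρ) := by
  ext ψ σ
  simp [permShift, LinearMap.funLeft, mul_assoc]

/-- Multiplication by the variable indexed by the image of `i`. -/
noncomputable def twist {ι : Type*} (i : ι) :
    Module.End (MvPolynomial ι ℂ) (Equiv.Perm ι → MvPolynomial ι ℂ) where
  toFun ψ σ := MvPolynomial.X (σ i) * ψ σ
  map_add' ψ φ := by ext1 σ; simp [mul_add]
  map_smul' r ψ := by ext1 σ; simp [mul_left_comm]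

theorem twist_apply {ι : Type*} (i : ι) (ψ : Equiv.Perm ι → MvPolynomial ι ℂ)
    (σ : Equiv.Perm ι) : twist i ψ σ = MvPolynomial.X (σ i) * ψ σ := rfl

theorem permShift_mul_twist {ι : Type*} (π : Equiv.Perm ι) (i : ι) :
    permShift (MvPolynomial ι ℂ) π * twist i = twist (π i) * permShift (MvPolynomial ι ℂ) π := by
  refine LinearMap.ext fun ψ => funext fun σ => ?_
  simp [permShift_apply, twist_apply]

theorem twist_comm {ι : Type*} (i j : ι) : twist i * twist j = twist j * twist i := by
  refine LinearMap.ext fun ψ => funext fun σ => ?_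
  simp [twist_apply, mul_left_comm]

/-- The Gaudin Hamiltonians of the symmetric group, twisted by diagonal matrices of variables. -/
noncomputable def gaudin {ι : Type*} [Fintype ι] [DecidableEq ι] (z : ι → ℂ) (i : ι) :
    Module.End (MvPolynomial ι ℂ) (Equiv.Perm ι → MvPolynomial ι ℂ) :=
  twist i + ∑ j, (MvPolynomial.C (z i - z j)⁻¹ : MvPolynomial ι ℂ) •
    permShift (MvPolynomial ι ℂ) (Equiv.swap i j)

theorem inv_sub_mul_inv_sub {a b c : ℂ} (hab : a ≠ b) (hbc : b ≠ c) (hac : a ≠ c) :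
    (a - b)⁻¹ * (b - c)⁻¹ = (a - c)⁻¹ * (a - b)⁻¹ + (a - c)⁻¹ * (b - c)⁻¹ := by
  have h1 := sub_ne_zero.2 hab
  have h2 := sub_ne_zero.2 hbc
  have h3 := sub_ne_zero.2 hac
  field_simp
  ring

theorem swap_mul_swap_cycle {ι : Type*} [DecidableEq ι] {i j m : ι} (hij : i ≠ j)
    (him : i ≠ m) (hjm : j ≠ m) :
    Equiv.swap i j * Equiv.swap j m = Equiv.swap j m * Equiv.swap i m ∧
    Equiv.swap i j * Equiv.swap j m = Equiv.swap i m * Equiv.swap i j := by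
  constructor <;>
  · ext x
    simp only [Equiv.Perm.mul_apply, Equiv.swap_apply_def]
    grind

theorem sum_smul_mul_sum_smul_sub {R A ι : Type*} [CommRing R] [Ring A] [Algebra R A] [Fintype ι]
    (a b : ι → R) (s t : ι → A) :
    (∑ l, a l • s l) * (∑ m, b m • t m) - (∑ m, b m • t m) * (∑ l, a l • s l) =
      ∑ l, ∑ m, (a l * b m) • (s l * t m - t m * s l) := by
  rw [Finset.sum_mul_sum, Finset.sum_mul_sum, Finset.sum_comm, ← Finset.sum_sub_distrib]
  rw [Finset.sum_comm]
  simp only [← Finset.sum_sub_distrib]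
  refine Finset.sum_congr rfl fun l _ => Finset.sum_congr rfl fun m _ => ?_
  rw [smul_mul_smul_comm, smul_mul_smul_comm, mul_comm (b l), smul_sub]

theorem gaudin_comm {ι : Type*} [Fintype ι] [DecidableEq ι] {z : ι → ℂ}
    (hz : Function.Injective z) (i j : ι) : gaudin z i * gaudin z j = gaudin z j * gaudin z i := by
  rcases eq_or_ne i j with rfl | hij
  · rfl
  set R := MvPolynomial ι ℂ
  set c : ι → ι → R := fun i j => MvPolynomial.C (z i - z j)⁻¹ with hc
  have hcself : ∀ i, c i i = 0 := fun i => by simp [hc]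
  have hcanti : ∀ i j, c i j = - c j i := fun i j => by
    simp only [hc, ← map_neg, ← inv_neg, neg_sub]
  have hctri : ∀ i j m, i ≠ j → j ≠ m → i ≠ m →
      c i j * c j m = c i m * c i j + c i m * c j m := fun i j m h1 h2 h3 => by
    simp only [hc, ← map_mul, ← map_add]
    rw [inv_sub_mul_inv_sub (hz.ne h1) (hz.ne h2) (hz.ne h3)]
  let s : ι → ι → Module.End R (Equiv.Perm ι → R) := fun i j => permShift R (Equiv.swap i j)
  have hssymm : ∀ i j, s i j = s j i := fun i j => by simp [s, Equiv.swap_comm]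
  let u : ι → ι → Module.End R (Equiv.Perm ι → R) := fun l m =>
    (c i l * c j m) • (s i l * s j m - s j m * s i l)
  have hu : ∀ l m, u l m = (if l = j then u j m else 0) + (if m = i then u l i else 0)
      + (if l = m then u m m else 0) := by
    have h1 : u j i = 0 := by simp [u, hssymm j i]
    have h2 : u j j = 0 := by simp [u, hcself]
    have h3 : u i i = 0 := by simp [u, hcself]
    have h4 : ∀ m, u i m = 0 := by simp [u, hcself]
    have h5 : ∀ m, u m j = 0 := by simp [u, hcself]
    intro l m
    by_cases hlj : l = j
    · subst hlj
      by_cases hmi : m = i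
      · subst hmi; simp [h1, hij.symm]
      · by_cases hlm : l = m
        · subst hlm; simp only [hmi, h2, if_true, if_false, add_zero]
        · simp only [hmi, hlm, if_true, if_false, add_zero]
    by_cases hmi : m = i
    · subst hmi
      by_cases hlm : l = m
      · subst hlm; simp only [hlj, h3, if_true, if_false, add_zero]
      · simp only [hlj, hlm, if_true, if_false, add_zero, zero_add]
    by_cases hlm : l = m
    · simp only [hlm ▸ hlj, hlm, hmi, if_true, if_false, zero_add]
    simp only [hlj, hmi, hlm, if_false, add_zero]
    by_cases hli : l = i
    · subst hli; exact h4 m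
    by_cases hmj : m = j
    · subst hmj; exact h5 l
    have : s i l * s j m = s j m * s i l := by
      simp only [s, permShift_mul]
      congr 1
      refine Equiv.Perm.Disjoint.commute ?_
      intro x
      simp only [Equiv.swap_apply_def]
      grind
    simp [u, this]
  have hsum : ∑ l, ∑ m, u l m = 0 := by
    have : ∑ l, ∑ m, u l m = ∑ m, (u j m + u m i + u m m) := by
      rw [Finset.sum_congr rfl fun l _ => Finset.sum_congr rfl fun m _ => hu l m]
      simp only [Finset.sum_add_distrib]
      congr 1
      · congr 1
        · rw [Finset.sum_comm]; simp
        · simp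
      · simp
    rw [this]
    refine Finset.sum_eq_zero fun m _ => ?_
    by_cases hmi : m = i
    · subst hmi; simp [u, hcself, hssymm j m]
    by_cases hmj : m = j
    · subst hmj; simp [u, hcself, hssymm m i]
    obtain ⟨e1, e2⟩ := swap_mul_swap_cycle hij (Ne.symm hmi) (Ne.symm hmj)
    obtain ⟨e3, e4⟩ := swap_mul_swap_cycle hij.symm (Ne.symm hmj) (Ne.symm hmi)
    have t := hctri i j m hij (Ne.symm hmj) (Ne.symm hmi)
    have f1 : s j m * s i m = s i j * s j m := by simp only [s, permShift_mul, e1]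
    have f2 : s i m * s i j = s i j * s j m := by simp only [s, permShift_mul, e2]
    have f3 : s i m * s j m = s i j * s i m := by
      simp only [s, permShift_mul, Equiv.swap_comm i j, e3]
    have f4 : s j m * s i j = s i j * s i m := by
      simp only [s, permShift_mul, Equiv.swap_comm i j, e4]
    simp only [u, hssymm j i, hcanti j i, f1, f2, f3, f4]
    have hcoef : c i j * c j m + c i m * (- c i j) - c i m * c j m = 0 := by rw [t]; ring
    have : (c i j * c j m) • (s i j * s j m - s i j * s i m) +
        (c i m * -c i j) • (s i j * s j m - s i j * s i m) +
        (c i m * c j m) • (s i j * s i m - s i j * s j m) =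
        (c i j * c j m + c i m * (- c i j) - c i m * c j m) •
          (s i j * s j m - s i j * s i m) := by module
    rw [this, hcoef, zero_smul]
  have hswap : ∀ (i j l : ι), i ≠ j → twist i * s j l - s j l * twist i =
      if l = i then (s i j * twist j - s i j * twist i : Module.End R _) else 0 := by
    intro i j l hij
    split_ifs with h
    · subst h
      simp only [s]
      rw [permShift_mul_twist, permShift_mul_twist, Equiv.swap_comm j l, permShift_mul_twist,
        Equiv.swap_apply_right, Equiv.swap_apply_left]
    · simp only [s]
      rw [permShift_mul_twist, Equiv.swap_apply_of_ne_of_ne hij (Ne.symm h), sub_self]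
  have hbr : ∀ i j, twist i * (∑ l, c j l • s j l) - (∑ l, c j l • s j l) * twist i =
      ∑ l, c j l • (twist i * s j l - s j l * twist i) := fun i j => by
    simp only [Finset.mul_sum, Finset.sum_mul, mul_smul_comm, smul_mul_assoc, smul_sub,
      Finset.sum_sub_distrib]
  have hss : (∑ l, c i l • s i l) * (∑ m, c j m • s j m) -
      (∑ m, c j m • s j m) * (∑ l, c i l • s i l) = ∑ l, ∑ m, u l m :=
    sum_smul_mul_sum_smul_sub (c i) (c j) (s i) (s j)
  have key : gaudin z i * gaudin z j - gaudin z j * gaudin z i =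
      (twist i * twist j - twist j * twist i) +
      ∑ l, c j l • (twist i * s j l - s j l * twist i) -
      ∑ l, c i l • (twist j * s i l - s i l * twist j) + ∑ l, ∑ m, u l m := by
    rw [← hbr, ← hbr, ← hss]
    change (twist i + ∑ l, c i l • s i l) * (twist j + ∑ l, c j l • s j l) -
      (twist j + ∑ l, c j l • s j l) * (twist i + ∑ l, c i l • s i l) = _
    generalize (∑ l, c i l • s i l) = S
    generalize (∑ l, c j l • s j l) = T
    noncomm_ring
  rw [← sub_eq_zero, key, hsum, twist_comm i j, sub_self]
  simp only [hswap i j _ hij, hswap j i _ hij.symm]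
  simp only [Finset.sum_ite_eq', Finset.mem_univ, if_true, smul_ite, smul_zero, hcanti j i,
    hssymm j i]
  module

theorem gaudin_apply {ι : Type*} [Fintype ι] [DecidableEq ι] (z : ι → ℂ) (i : ι)
    (ψ : Equiv.Perm ι → MvPolynomial ι ℂ) (σ : Equiv.Perm ι) :
    gaudin z i ψ σ = MvPolynomial.X (σ i) * ψ σ +
      ∑ j, MvPolynomial.C (z i - z j)⁻¹ * ψ (σ * Equiv.swap i j) := by
  simp [gaudin, twist_apply, permShift_apply]

/-- The Calogero–Moser Lax matrix with positions `z` and momenta `h`. -/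
noncomputable def calogeroMoser {ι B : Type*} [DecidableEq ι] [CommRing B] [Algebra ℂ B]
    (z : ι → ℂ) (h : ι → B) : Matrix ι ι B :=
  Matrix.diagonal h - Matrix.of fun i j => algebraMap ℂ B (z i - z j)⁻¹

theorem calogeroMoser_map {ι A B : Type*} [DecidableEq ι] [CommRing A] [Algebra ℂ A]
    [CommRing B] [Algebra ℂ B] (f : A →ₐ[ℂ] B) (z : ι → ℂ) (h : ι → A) :
    (calogeroMoser z h).map f = calogeroMoser z (fun i => f (h i)) := by
  ext i j
  by_cases hij : i = j <;> simp [calogeroMoser, hij]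

theorem map_trace_calogeroMoser_pow {ι A B : Type*} [Fintype ι] [DecidableEq ι] [CommRing A]
    [Algebra ℂ A] [CommRing B] [Algebra ℂ B] (f : A →ₐ[ℂ] B) (z : ι → ℂ) (h : ι → A) (k : ℕ) :
    f ((calogeroMoser z h ^ k).trace) = (calogeroMoser z (fun i => f (h i)) ^ k).trace := by
  rw [← calogeroMoser_map]
  have := AddMonoidHom.map_trace (f : A →+ B) (calogeroMoser z h ^ k)
  simp only [AddMonoidHom.coe_coe] at this
  rw [this]
  congr 1
  exact Matrix.map_pow (calogeroMoser z h) (f : A →+* B) k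

theorem trace_calogeroMoser_pow {ι B : Type*} [Fintype ι] [DecidableEq ι] [CommRing B]
    [Algebra ℂ B] {z : ι → ℂ} (hz : Function.Injective z) (h : ι → B) (k : ℕ) :
    (calogeroMoser z h ^ k).trace = ∑ i, ∑ j, (calogeroMoser z h ^ k) i j := by
  set Y := calogeroMoser z h
  set Z : Matrix ι ι B := Matrix.diagonal fun i => algebraMap ℂ B (z i)
  have hcomm : Z * Y - Y * Z = 1 - Matrix.of fun _ _ => 1 := by
    ext i j
    simp only [Z, Matrix.sub_apply, Matrix.diagonal_mul, Matrix.mul_diagonal, Y, calogeroMoser,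
      Matrix.of_apply]
    by_cases hij : i = j
    · subst hij; simp [mul_comm]
    · have : algebraMap ℂ B (z i - z j) * algebraMap ℂ B (z i - z j)⁻¹ = 1 := by
        rw [← map_mul, mul_inv_cancel₀ (sub_ne_zero.2 (hz.ne hij)), map_one]
      simp only [Matrix.diagonal_apply_ne _ hij, Matrix.one_apply_ne hij]
      rw [map_sub] at this
      linear_combination -this
  have h1 : (Y ^ k * (Z * Y - Y * Z)).trace = 0 := by
    rw [mul_sub, Matrix.trace_sub, ← mul_assoc, Matrix.trace_mul_comm, ← mul_assoc, ← mul_assoc,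
      ← pow_succ, ← pow_succ', sub_self]
  rw [hcomm, mul_sub, Matrix.trace_sub, mul_one, sub_eq_zero] at h1
  rw [h1]
  simp [Matrix.trace, Matrix.mul_apply]

/-- Polynomials all of whose monomials have degree less than `k`. -/
def degreeBelow (ι : Type*) (k : ℕ) : Submodule ℂ (MvPolynomial ι ℂ) where
  carrier := {p | ∀ s : ι →₀ ℕ, k ≤ s.degree → p.coeff s = 0}
  add_mem' hp hq s hs := by simp [hp s hs, hq s hs]
  zero_mem' s _ := by simp
  smul_mem' c p hp s hs := by simp [hp s hs]

theorem degreeBelow_mono {ι : Type*} {k l : ℕ} (h : k ≤ l) : degreeBelow ι k ≤ degreeBelow ι l :=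
  fun _ hp s hs => hp s (h.trans hs)

theorem X_mul_mem_degreeBelow {ι : Type*} {k : ℕ} {p : MvPolynomial ι ℂ} (i : ι)
    (hp : p ∈ degreeBelow ι k) : MvPolynomial.X i * p ∈ degreeBelow ι (k + 1) := by
  classical
  intro s hs
  rw [MvPolynomial.coeff_X_mul']
  split_ifs with h
  · refine hp _ ?_
    have : s = (s - Finsupp.single i 1) + Finsupp.single i 1 := by
      rw [tsub_add_cancel_of_le]
      rw [Finsupp.single_le_iff]
      exact Nat.one_le_iff_ne_zero.2 (Finsupp.mem_support_iff.1 h)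
    rw [this, map_add, Finsupp.degree_single] at hs
    omega
  · rfl

theorem monomial_mem_degreeBelow {ι : Type*} (s : ι →₀ ℕ) (a : ℂ) :
    MvPolynomial.monomial s a ∈ degreeBelow ι (s.degree + 1) := by
  classical
  intro t ht
  rw [MvPolynomial.coeff_monomial, if_neg]
  rintro rfl
  omega

theorem algebraMap_smul_perm {ι B : Type*} [CommRing B] [Algebra (MvPolynomial ι ℂ) B]
    [Algebra ℂ B] [IsScalarTower ℂ (MvPolynomial ι ℂ) B]
    [Module B (Equiv.Perm ι → MvPolynomial ι ℂ)]
    [IsScalarTower (MvPolynomial ι ℂ) B (Equiv.Perm ι → MvPolynomial ι ℂ)] (a : ℂ)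
    (ψ : Equiv.Perm ι → MvPolynomial ι ℂ) :
    algebraMap ℂ B a • ψ = (MvPolynomial.C a : MvPolynomial ι ℂ) • ψ := by
  rw [IsScalarTower.algebraMap_apply ℂ (MvPolynomial ι ℂ) B, algebraMap_smul]
  rfl

section

variable {ι B : Type*} [Fintype ι] [DecidableEq ι] [CommRing B] [Algebra (MvPolynomial ι ℂ) B]
  [Algebra ℂ B] [IsScalarTower ℂ (MvPolynomial ι ℂ) B]
  [Module B (Equiv.Perm ι → MvPolynomial ι ℂ)]
  [IsScalarTower (MvPolynomial ι ℂ) B (Equiv.Perm ι → MvPolynomial ι ℂ)]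
  {z : ι → ℂ} {H : ι → B}

theorem trace_calogeroMoser_pow_smul_one (hz : Function.Injective z)
    (hH : ∀ i ψ, H i • ψ = gaudin z i ψ) (k : ℕ) :
    (calogeroMoser z H ^ k).trace • (1 : Equiv.Perm ι → MvPolynomial ι ℂ) =
      MvPolynomial.psum ι ℂ k • (1 : Equiv.Perm ι → MvPolynomial ι ℂ) := by
  have key : ∀ k i, ∑ j, (calogeroMoser z H ^ k) i j • (1 : Equiv.Perm ι → MvPolynomial ι ℂ) =
      fun σ => MvPolynomial.X (σ i) ^ k := by
    intro k
    induction k with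
    | zero =>
      intro i
      simp only [pow_zero, Matrix.one_apply, ite_smul, one_smul, zero_smul, Finset.sum_ite_eq,
        Finset.mem_univ, if_true]
      rfl
    | succ k ih =>
      intro i
      have : ∀ j, (calogeroMoser z H ^ (k + 1)) i j =
          ∑ l, calogeroMoser z H i l * (calogeroMoser z H ^ k) l j := fun j => by
        rw [pow_succ', Matrix.mul_apply]
      simp only [this, Finset.sum_smul, mul_smul]
      rw [Finset.sum_comm]
      simp only [← Finset.smul_sum, ih]
      simp only [calogeroMoser, Matrix.sub_apply, Matrix.diagonal_apply, Matrix.of_apply, sub_smul,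
        Finset.sum_sub_distrib, ite_smul, zero_smul, Finset.sum_ite_eq, Finset.mem_univ, if_true,
        algebraMap_smul_perm, hH]
      ext1 σ
      simp only [Pi.sub_apply, gaudin_apply, Finset.sum_apply, Pi.smul_apply, smul_eq_mul,
        Equiv.Perm.mul_apply, Equiv.swap_apply_left]
      ring
  rw [trace_calogeroMoser_pow hz, Finset.sum_smul]
  simp only [Finset.sum_smul, key]
  ext1 σ
  simp only [Finset.sum_apply, Pi.smul_apply, Pi.one_apply, smul_eq_mul, mul_one,
    MvPolynomial.psum]
  exact Equiv.sum_comp σ fun i => (MvPolynomial.X i : MvPolynomial ι ℂ) ^ k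

theorem monomial_smul_one_sub_mem (hH : ∀ i ψ, H i • ψ = gaudin z i ψ) (s : ι →₀ ℕ) (a : ℂ)
    (σ : Equiv.Perm ι) :
    (MvPolynomial.aeval H (MvPolynomial.monomial s a) • (1 : Equiv.Perm ι → MvPolynomial ι ℂ)) σ -
      MvPolynomial.monomial (s.mapDomain σ) a ∈ degreeBelow ι s.degree := by
  obtain ⟨n, hn⟩ : ∃ n, n = s.degree := ⟨_, rfl⟩
  induction n generalizing s σ with
  | zero =>
    obtain rfl : s = 0 := (Finsupp.degree_eq_zero_iff s).1 hn.symm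
    simp [algebraMap_smul_perm]
  | succ n ih =>
    have hs : s ≠ 0 := by rintro rfl; simp at hn
    obtain ⟨i, hi⟩ := Finsupp.support_nonempty_iff.2 hs
    obtain ⟨t, rfl⟩ : ∃ t, s = t + Finsupp.single i 1 := by
      refine ⟨s - Finsupp.single i 1, (tsub_add_cancel_of_le ?_).symm⟩
      rw [Finsupp.single_le_iff]
      exact Nat.one_le_iff_ne_zero.2 (Finsupp.mem_support_iff.1 hi)
    have ht : n = t.degree := by
      rw [map_add, Finsupp.degree_single] at hn
      omega
    set φ := MvPolynomial.aeval H (MvPolynomial.monomial t a) •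
      (1 : Equiv.Perm ι → MvPolynomial ι ℂ) with hφ
    have hlow : ∀ τ, φ τ ∈ degreeBelow ι (t.degree + 1) := fun τ => by
      have h1 := degreeBelow_mono (Nat.le_succ _) (ih t τ ht)
      have h2 := monomial_mem_degreeBelow (t.mapDomain τ) a
      rw [Finsupp.degree_mapDomain] at h2
      simpa using Submodule.add_mem _ h1 h2
    have hstep : MvPolynomial.aeval H (MvPolynomial.monomial (t + Finsupp.single i 1) a) •
        (1 : Equiv.Perm ι → MvPolynomial ι ℂ) = gaudin z i φ := by
      rw [MvPolynomial.monomial_add_single, pow_one, mul_comm, map_mul, MvPolynomial.aeval_X,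
        mul_smul, hH]
    rw [hstep, gaudin_apply, Finsupp.mapDomain_add, Finsupp.mapDomain_single,
      MvPolynomial.monomial_add_single, pow_one, map_add, Finsupp.degree_single]
    have h3 := X_mul_mem_degreeBelow (σ i) (ih t σ ht)
    have h4 : ∑ j, MvPolynomial.C (z i - z j)⁻¹ * φ (σ * Equiv.swap i j) ∈
        degreeBelow ι (t.degree + 1) :=
      Submodule.sum_mem _ fun j _ => by
        rw [MvPolynomial.C_mul']
        exact Submodule.smul_mem _ _ (hlow _)
    convert Submodule.add_mem _ h3 h4 using 1
    ring

theorem aeval_smul_one_ne_zero (hH : ∀ i ψ, H i • ψ = gaudin z i ψ) {f : MvPolynomial ι ℂ}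
    (hf : f ≠ 0) :
    MvPolynomial.aeval H f • (1 : Equiv.Perm ι → MvPolynomial ι ℂ) ≠ 0 := by
  intro h0
  obtain ⟨s, hs, hmax⟩ := Finset.exists_max_image f.support Finsupp.degree
    (MvPolynomial.support_nonempty.2 hf)
  have hmem : (MvPolynomial.aeval H f • (1 : Equiv.Perm ι → MvPolynomial ι ℂ)) 1 - f ∈
      degreeBelow ι s.degree := by
    have hsum : (MvPolynomial.aeval H f • (1 : Equiv.Perm ι → MvPolynomial ι ℂ)) 1 - f =
        ∑ t ∈ f.support, ((MvPolynomial.aeval H (MvPolynomial.monomial t (f.coeff t)) •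
          (1 : Equiv.Perm ι → MvPolynomial ι ℂ)) 1 - MvPolynomial.monomial t (f.coeff t)) := by
      rw [Finset.sum_sub_distrib, ← Finset.sum_apply, ← Finset.sum_smul, ← map_sum, ← f.as_sum]
    rw [hsum]
    refine Submodule.sum_mem _ fun t ht => degreeBelow_mono (hmax t ht) ?_
    have := monomial_smul_one_sub_mem hH t (f.coeff t) 1
    rwa [Equiv.Perm.coe_one, Finsupp.mapDomain_id] at this
  have := hmem s le_rfl
  rw [h0] at this
  simp at this
  exact MvPolynomial.mem_support_iff.1 hs this

end

theorem exists_aeval_psum_eq {ι : Type*} [Fintype ι] {p : MvPolynomial ι ℂ} (hp : p.IsSymmetric) :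
    ∃ G : MvPolynomial ℕ ℂ, MvPolynomial.aeval (fun k => MvPolynomial.psum ι ℂ (k + 1)) G = p := by
  classical
  set Φ := MvPolynomial.aeval (R := ℂ) fun k => MvPolynomial.psum ι ℂ (k + 1) with hΦ
  have hpsum : ∀ k, k ≠ 0 → MvPolynomial.psum ι ℂ k ∈ Φ.range := fun k hk =>
    ⟨MvPolynomial.X (k - 1), by
      change Φ _ = _
      rw [hΦ, MvPolynomial.aeval_X, Nat.sub_add_cancel (Nat.pos_of_ne_zero hk)]⟩
  have hesymm : ∀ k, MvPolynomial.esymm ι ℂ k ∈ Φ.range := by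
    intro k
    induction k using Nat.strong_induction_on with
    | _ k ih =>
      rcases Nat.eq_zero_or_pos k with rfl | hk
      · rw [MvPolynomial.esymm_zero]; exact one_mem _
      have hmem : (k : MvPolynomial ι ℂ) * MvPolynomial.esymm ι ℂ k ∈ Φ.range := by
        rw [MvPolynomial.mul_esymm_eq_sum]
        refine mul_mem (pow_mem (neg_mem (one_mem _)) _) (sum_mem fun a ha => ?_)
        rw [Finset.mem_filter] at ha
        have ha1 := Finset.HasAntidiagonal.mem_antidiagonal.1 ha.1
        have ha2 := ha.2
        have ha3 : a.2 ≠ 0 := by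
          intro h
          rw [h] at ha1
          omega
        exact mul_mem (mul_mem (pow_mem (neg_mem (one_mem _)) _) (ih _ ha.2))
          (hpsum _ ha3)
      have : MvPolynomial.esymm ι ℂ k =
          (k : ℂ)⁻¹ • ((k : MvPolynomial ι ℂ) * MvPolynomial.esymm ι ℂ k) := by
        rw [← nsmul_eq_mul, ← Nat.cast_smul_eq_nsmul ℂ, smul_smul, inv_mul_cancel₀, one_smul]
        exact_mod_cast hk.ne'
      rw [this]
      exact Subalgebra.smul_mem _ hmem _
  obtain ⟨q, hq⟩ := MvPolynomial.esymmAlgHom_surjective (σ := ι) ℂ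
    (le_refl (Fintype.card ι)) ⟨p, hp⟩
  have hq' : MvPolynomial.aeval (fun i : Fin (Fintype.card ι) => MvPolynomial.esymm ι ℂ (i + 1)) q
      = p := by
    rw [← MvPolynomial.esymmAlgHom_apply, hq]
  change p ∈ Φ.range
  rw [← hq']
  clear hq hq'
  induction q using MvPolynomial.induction_on with
  | C a => rw [MvPolynomial.aeval_C]; exact Subalgebra.algebraMap_mem _ a
  | add q r hq hr => rw [map_add]; exact add_mem hq hr
  | mul_X q i hq => rw [map_mul, MvPolynomial.aeval_X]; exact mul_mem hq (hesymm _)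

section

variable {ι B : Type*} [Fintype ι] [DecidableEq ι] [CommRing B] [Algebra (MvPolynomial ι ℂ) B]
  [Algebra ℂ B] [IsScalarTower ℂ (MvPolynomial ι ℂ) B]
  [Module B (Equiv.Perm ι → MvPolynomial ι ℂ)]
  [IsScalarTower (MvPolynomial ι ℂ) B (Equiv.Perm ι → MvPolynomial ι ℂ)]
  {z : ι → ℂ} {H : ι → B}

theorem aeval_trace_smul_one (hz : Function.Injective z)
    (hH : ∀ i ψ, H i • ψ = gaudin z i ψ) (G : MvPolynomial ℕ ℂ) :
    MvPolynomial.aeval (fun k => (calogeroMoser z H ^ (k + 1)).trace) G •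
      (1 : Equiv.Perm ι → MvPolynomial ι ℂ) =
    MvPolynomial.aeval (fun k => MvPolynomial.psum ι ℂ (k + 1)) G •
      (1 : Equiv.Perm ι → MvPolynomial ι ℂ) := by
  induction G using MvPolynomial.induction_on with
  | C a =>
    rw [MvPolynomial.aeval_C, MvPolynomial.aeval_C, algebraMap_smul_perm]
    rfl
  | add p q hp hq => rw [map_add, map_add, add_smul, add_smul, hp, hq]
  | mul_X p k hp =>
    rw [map_mul, map_mul, MvPolynomial.aeval_X, MvPolynomial.aeval_X, mul_smul,
      trace_calogeroMoser_pow_smul_one hz hH, smul_algebra_smul_comm, hp, ← mul_smul, mul_comm]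

theorem eval_eq_zero_of_aeval_smul_one (hz : Function.Injective z)
    (hH : ∀ i ψ, H i • ψ = gaudin z i ψ) (i : ι) {F : Polynomial (MvPolynomial ι ℂ)}
    (hF : ∀ k, (F.coeff k).IsSymmetric)
    (hFH : Polynomial.aeval (H i) F • (1 : Equiv.Perm ι → MvPolynomial ι ℂ) = 0)
    {h : ι → ℂ} (hh : ∀ k, (calogeroMoser z h ^ (k + 1)).trace = 0) :
    (F.map (MvPolynomial.eval 0)).eval (h i) = 0 := by
  choose G hG using fun k => exists_aeval_psum_eq (hF k)
  set f : MvPolynomial ι ℂ := ∑ k ∈ Finset.range (F.natDegree + 1),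
    MvPolynomial.aeval (fun l => (calogeroMoser z (MvPolynomial.X (R := ℂ)) ^ (l + 1)).trace)
      (G k) *
      MvPolynomial.X i ^ k with hf
  have hfH : MvPolynomial.aeval H f • (1 : Equiv.Perm ι → MvPolynomial ι ℂ) = 0 := by
    rw [← hFH, hf, Polynomial.aeval_eq_sum_range, map_sum, Finset.sum_smul, Finset.sum_smul]
    refine Finset.sum_congr rfl fun k _ => ?_
    rw [map_mul, map_pow, MvPolynomial.aeval_X, MvPolynomial.comp_aeval_apply, mul_comm, mul_smul]
    simp only [map_trace_calogeroMoser_pow, MvPolynomial.aeval_X]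
    rw [aeval_trace_smul_one hz hH, hG, smul_algebra_smul_comm, smul_assoc]
  have hf0 : f = 0 := by
    by_contra hne
    exact aeval_smul_one_ne_zero hH hne hfH
  have h1 : MvPolynomial.aeval h f = 0 := by rw [hf0, map_zero]
  rw [Polynomial.eval_map, Polynomial.eval₂_eq_sum_range, ← h1, hf, map_sum]
  refine Finset.sum_congr rfl fun k _ => ?_
  rw [map_mul, map_pow, MvPolynomial.aeval_X, MvPolynomial.comp_aeval_apply, ← hG k]
  congr 1
  simp only [map_trace_calogeroMoser_pow, MvPolynomial.aeval_X, hh]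
  rw [← MvPolynomial.coe_aeval_eq_eval, RingHom.coe_coe, MvPolynomial.comp_aeval_apply]
  congr 2
  ext k
  simp [MvPolynomial.psum]

end

theorem eval_eq_zero_of_aeval_algHom {ι B : Type*} [Fintype ι] [DecidableEq ι] {z : ι → ℂ}
    [CommRing B] [Algebra (MvPolynomial ι ℂ) B]
    (φ : B →ₐ[MvPolynomial ι ℂ] Module.End (MvPolynomial ι ℂ) (Equiv.Perm ι → MvPolynomial ι ℂ))
    (hz : Function.Injective z) (H : ι → B) (hH : ∀ i, φ (H i) = gaudin z i)
    (i : ι) {F : Polynomial (MvPolynomial ι ℂ)}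
    (hF : ∀ k, (F.coeff k).IsSymmetric) (hFH : Polynomial.aeval (H i) F = 0)
    {h : ι → ℂ} (hh : ∀ k, (calogeroMoser z h ^ (k + 1)).trace = 0) :
    (F.map (MvPolynomial.eval 0)).eval (h i) = 0 := by
  let : Algebra ℂ B := ((algebraMap (MvPolynomial ι ℂ) B).comp MvPolynomial.C).toAlgebra
  let : Module B (Equiv.Perm ι → MvPolynomial ι ℂ) := Module.compHom _ φ.toRingHom
  have : IsScalarTower ℂ (MvPolynomial ι ℂ) B := IsScalarTower.of_algebraMap_eq fun _ => rfl
  have : IsScalarTower (MvPolynomial ι ℂ) B (Equiv.Perm ι → MvPolynomial ι ℂ) :=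
    ⟨fun r b ψ => by
      change φ (r • b) ψ = r • φ b ψ
      rw [map_smul]
      rfl⟩
  refine eval_eq_zero_of_aeval_smul_one (H := H) hz (fun i ψ => ?_) i hF ?_ hh
  · rw [← hH]
    rfl
  · rw [hFH, zero_smul]

open IsMulCommutative in
theorem eval_eq_zero_of_aeval_gaudin {ι : Type*} [Fintype ι] [DecidableEq ι] {z : ι → ℂ}
    (hz : Function.Injective z) (i : ι) {F : Polynomial (MvPolynomial ι ℂ)}
    (hF : ∀ k, (F.coeff k).IsSymmetric) (hFH : Polynomial.aeval (gaudin z i) F = 0)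
    {h : ι → ℂ} (hh : ∀ k, (calogeroMoser z h ^ (k + 1)).trace = 0) :
    (F.map (MvPolynomial.eval 0)).eval (h i) = 0 := by
  have : IsMulCommutative (Algebra.adjoin (MvPolynomial ι ℂ) (Set.range (gaudin z))) :=
    Algebra.isMulCommutative_adjoin _ (by
      rintro _ ⟨i, rfl⟩ _ ⟨j, rfl⟩
      exact gaudin_comm hz i j)
  let H : ι → Algebra.adjoin (MvPolynomial ι ℂ) (Set.range (gaudin z)) := fun i =>
    ⟨gaudin z i, Algebra.subset_adjoin ⟨i, rfl⟩⟩
  refine eval_eq_zero_of_aeval_algHom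
    (Subalgebra.val (Algebra.adjoin (MvPolynomial ι ℂ) (Set.range (gaudin z)))) hz
    H (fun i => rfl) i hF ?_ hh
  apply Subtype.ext
  rw [ZeroMemClass.coe_zero, ← hFH]
  exact (Polynomial.aeval_algHom_apply (Subalgebra.val _) _ F).symm

theorem calogeroMoser_momenta_real {ι : Type*} [Fintype ι] [DecidableEq ι] {z : ι → ℂ}
    (hz : Function.Injective z) (hzr : ∀ i, (z i).im = 0) {h : ι → ℂ}
    (hh : ∀ k, (calogeroMoser z h ^ (k + 1)).trace = 0) (i : ι) : (h i).im = 0 := by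
  set χ := (gaudin z i).charpoly
  set F := ∏ π : Equiv.Perm ι, χ.map (MvPolynomial.rename (R := ℂ) π : _ →+* MvPolynomial ι ℂ)
  have hF : ∀ k, (F.coeff k).IsSymmetric := by
    intro k τ
    have : F.map (MvPolynomial.rename (R := ℂ) τ : _ →+* MvPolynomial ι ℂ) = F := by
      rw [Polynomial.map_prod]
      simp only [Polynomial.map_map]
      refine Fintype.prod_equiv (Equiv.mulLeft τ) _ _ fun π => ?_
      congr 1
      exact MvPolynomial.ringHom_ext (by simp) (by simp)
    conv_rhs => rw [← this]
    rw [Polynomial.coeff_map]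
    rfl
  have hFH : Polynomial.aeval (gaudin z i) F = 0 := by
    have hdvd : χ ∣ F := by
      have := Finset.dvd_prod_of_mem (fun π : Equiv.Perm ι =>
        χ.map (MvPolynomial.rename (R := ℂ) π : _ →+* MvPolynomial ι ℂ)) (Finset.mem_univ 1)
      convert this
      symm
      have h1 : ((MvPolynomial.rename (R := ℂ) (1 : Equiv.Perm ι) : _ →ₐ[ℂ] MvPolynomial ι ℂ) :
          MvPolynomial ι ℂ →+* MvPolynomial ι ℂ) = RingHom.id _ :=
        MvPolynomial.ringHom_ext (by simp) (by simp)
      rw [h1, Polynomial.map_id]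
    obtain ⟨q, hq⟩ := hdvd
    rw [hq, map_mul, LinearMap.aeval_self_charpoly, zero_mul]
  have h1 := eval_eq_zero_of_aeval_gaudin hz i hF hFH hh
  have hmat : (χ.map (MvPolynomial.eval 0)).eval (h i) = 0 := by
    rw [Polynomial.map_prod, Polynomial.eval_prod, Finset.prod_eq_zero_iff] at h1
    obtain ⟨π, -, h2⟩ := h1
    rw [Polynomial.map_map] at h2
    have h3 : (MvPolynomial.eval (0 : ι → ℂ)).comp
        (MvPolynomial.rename (R := ℂ) π : MvPolynomial ι ℂ →+* MvPolynomial ι ℂ) =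
          MvPolynomial.eval 0 :=
      MvPolynomial.ringHom_ext (by simp) (by simp)
    rwa [h3] at h2
  have hχ : χ = (LinearMap.toMatrix (Pi.basisFun (MvPolynomial ι ℂ) (Equiv.Perm ι))
    (Pi.basisFun _ _) (gaudin z i)).charpoly := (LinearMap.charpoly_toMatrix _ _).symm
  rw [hχ, ← Matrix.charpoly_map] at hmat
  set A := (LinearMap.toMatrix (Pi.basisFun (MvPolynomial ι ℂ) (Equiv.Perm ι))
    (Pi.basisFun _ _) (gaudin z i)).map (MvPolynomial.eval (0 : ι → ℂ)) with hA
  have hAh : A.IsHermitian := by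
    have hentry : ∀ σ τ, A σ τ = ∑ j, if σ * Equiv.swap i j = τ then (z i - z j)⁻¹ else 0 := by
      intro σ τ
      rw [hA, Matrix.map_apply, LinearMap.toMatrix_apply, Pi.basisFun_apply, Pi.basisFun_repr,
        gaudin_apply]
      simp [Pi.single_apply, apply_ite]
    ext σ τ
    rw [Matrix.conjTranspose_apply, hentry, hentry, star_sum]
    refine Finset.sum_congr rfl fun j _ => ?_
    have h1 : τ * Equiv.swap i j = σ ↔ σ * Equiv.swap i j = τ := by
      constructor <;> rintro rfl <;> simp [mul_assoc]
    simp only [h1]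
    split_ifs
    · rw [star_inv₀, star_sub]
      simp only [Complex.star_def, Complex.conj_eq_iff_im.2 (hzr _)]
    · simp
  have hmem : h i ∈ A.charpoly.roots := (Polynomial.mem_roots A.charpoly_monic.ne_zero).2 hmat
  rw [hAh.roots_charpoly_eq_eigenvalues] at hmem
  obtain ⟨σ, -, hσ⟩ := Multiset.mem_map.1 hmem
  rw [← hσ]
  exact Complex.ofReal_im _

/-- The determinant of derivatives of `p`, the `i`-th row being differentiated `r i` times. -/
noncomputable def wronskianMinor {R : Type*} [CommRing R] {n : ℕ} (p : Fin n → Polynomial R)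
    (r : Fin n → ℕ) : Polynomial R :=
  (Matrix.of fun i j => Polynomial.derivative^[r i] (p j)).det

/-- The increasing enumeration of the natural numbers other than `k`. -/
def skipAt (k i : ℕ) : ℕ := if i < k then i else i + 1

/-- The coefficients of the differential operator `f ↦ Wr(f, p₁, …, pₙ)`. -/
noncomputable def wronskianCoeff {R : Type*} [CommRing R] {n : ℕ} (p : Fin n → Polynomial R)
    (k : ℕ) : Polynomial R :=
  (-1) ^ k * wronskianMinor p fun i => skipAt k i

theorem derivative_det {R m : Type*} [CommRing R] [Fintype m] [DecidableEq m]
    (M : Matrix m m (Polynomial R)) :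
    Polynomial.derivative M.det =
      ∑ i, (M.updateRow i fun j => Polynomial.derivative (M i j)).det := by
  have hdet : ∀ N : Matrix m m (Polynomial R), N.det =
      ∑ σ : Equiv.Perm m, Equiv.Perm.sign σ • ∏ i, N i (σ i) := fun N => by
    rw [← Matrix.det_transpose, Matrix.det_apply]
    rfl
  simp only [hdet, Polynomial.derivative_sum, Polynomial.derivative_smul]
  rw [Finset.sum_comm]
  refine Finset.sum_congr rfl fun σ _ => ?_
  rw [← Finset.smul_sum]
  congr 1
  rw [Polynomial.derivative_prod_finset]
  refine Finset.sum_congr rfl fun i _ => ?_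
  rw [← Finset.mul_prod_erase _ _ (Finset.mem_univ i)]
  simp only [Matrix.updateRow_self]
  rw [mul_comm]
  congr 1
  refine Finset.prod_congr rfl fun j hj => ?_
  rw [Matrix.updateRow_ne (Finset.ne_of_mem_erase hj)]

theorem derivative_wronskianMinor {R : Type*} [CommRing R] {n : ℕ}
    (p : Fin (n + 1) → Polynomial R) :
    Polynomial.derivative (wronskianMinor p fun i => i) =
      wronskianMinor p fun i => skipAt n i := by
  rw [wronskianMinor, derivative_det, Finset.sum_eq_single (Fin.last n)]
  · rw [wronskianMinor]
    congr 1
    ext i j : 2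
    rcases eq_or_ne i (Fin.last n) with rfl | hi
    · simp [skipAt, Function.iterate_succ_apply']
    · rw [Matrix.updateRow_ne hi]
      have : (i : ℕ) < n := Fin.val_lt_last hi
      simp [skipAt, this]
  · intro i _ hi
    have hi' : (i : ℕ) < n := Fin.val_lt_last hi
    have hne : i ≠ ⟨i + 1, by omega⟩ := by
      intro h
      have := congrArg Fin.val h
      simp at this
    refine Matrix.det_zero_of_row_eq hne ?_
    rw [Matrix.updateRow_self, Matrix.updateRow_ne hne.symm]
    ext1 j
    simp [Function.iterate_succ_apply']
  · simp

theorem sum_wronskianCoeff_mul {R : Type*} [CommRing R] {n : ℕ} (p : Fin n → Polynomial R)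
    (f : Polynomial R) :
    ∑ k ∈ Finset.range (n + 1), wronskianCoeff p k * Polynomial.derivative^[k] f =
      wronskianMinor (Fin.cons f p : Fin (n + 1) → Polynomial R) fun i => i := by
  rw [wronskianMinor, Matrix.det_succ_column_zero, Finset.sum_range]
  refine Finset.sum_congr rfl fun k _ => ?_
  rw [wronskianCoeff, mul_right_comm, wronskianMinor]
  simp only [Matrix.of_apply, Fin.cons_zero]
  congr 2
  ext i j : 2
  simp only [Matrix.of_apply, Matrix.submatrix_apply, Fin.cons_succ, skipAt, Fin.succAbove,
    Fin.lt_def, Fin.val_castSucc]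
  split_ifs <;> simp

theorem sum_wronskianCoeff_mul_self {R : Type*} [CommRing R] {n : ℕ} (p : Fin n → Polynomial R)
    (j : Fin n) :
    ∑ k ∈ Finset.range (n + 1), wronskianCoeff p k * Polynomial.derivative^[k] (p j) = 0 := by
  rw [sum_wronskianCoeff_mul]
  refine Matrix.det_zero_of_column_eq (i := 0) (j := j.succ) (Fin.succ_ne_zero j).symm ?_
  intro i
  simp

theorem wronskianCoeff_self {R : Type*} [CommRing R] {n : ℕ} (p : Fin n → Polynomial R) :
    wronskianCoeff p n = (-1) ^ n * wronskianMinor p fun i => i := by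
  simp [wronskianCoeff, skipAt]

theorem wronskianMinor_sum_smul {R : Type*} [CommRing R] {n : ℕ} (p q : Fin n → Polynomial R)
    (c : Matrix (Fin n) (Fin n) R) (h : ∀ j, q j = ∑ i, c i j • p i) (r : Fin n → ℕ) :
    wronskianMinor q r = wronskianMinor p r * Polynomial.C c.det := by
  have hC : Polynomial.C c.det = (c.map Polynomial.C).det := RingHom.map_det Polynomial.C c
  rw [wronskianMinor, wronskianMinor, hC, ← Matrix.det_mul]
  congr 1
  refine Matrix.ext fun i j => ?_
  rw [Matrix.mul_apply, Matrix.of_apply, h, Polynomial.iterate_derivative_sum]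
  refine Finset.sum_congr rfl fun k _ => ?_
  rw [Polynomial.iterate_derivative_smul, Matrix.of_apply, Matrix.map_apply, mul_comm,
    Polynomial.smul_eq_C_mul]

theorem natDegree_prod_le_sum_and_coeff {R ι : Type*} [CommRing R] (s : Finset ι)
    {f : ι → Polynomial R} {d : ι → ℕ} (h : ∀ i, (f i).natDegree ≤ d i) :
    (∏ i ∈ s, f i).natDegree ≤ ∑ i ∈ s, d i ∧
      (∏ i ∈ s, f i).coeff (∑ i ∈ s, d i) = ∏ i ∈ s, (f i).coeff (d i) := by
  classical
  induction s using Finset.induction_on with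
  | empty => simp
  | insert a s ha ih =>
    rw [Finset.prod_insert ha, Finset.sum_insert ha, Finset.prod_insert ha, ← ih.2]
    exact ⟨Polynomial.natDegree_mul_le_of_le (h a) ih.1,
      Polynomial.coeff_mul_add_eq_of_natDegree_le (h a) ih.1⟩

theorem natDegree_det_le_and_coeff {R m : Type*} [CommRing R] [Fintype m] [DecidableEq m]
    {M : Matrix m m (Polynomial R)} {d : m → ℕ} (h : ∀ i j, (M i j).natDegree ≤ d j) :
    M.det.natDegree ≤ ∑ j, d j ∧
      M.det.coeff (∑ j, d j) = (Matrix.of fun i j => (M i j).coeff (d j)).det := by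
  constructor
  · rw [Matrix.det_apply]
    refine Polynomial.natDegree_sum_le_of_forall_le _ _ fun σ _ => ?_
    refine (Polynomial.natDegree_smul_le _ _).trans ?_
    exact (natDegree_prod_le_sum_and_coeff Finset.univ fun j => h (σ j) j).1
  · rw [Matrix.det_apply, Matrix.det_apply, Polynomial.finsetSum_coeff]
    refine Finset.sum_congr rfl fun σ _ => ?_
    rw [Polynomial.coeff_smul,
      (natDegree_prod_le_sum_and_coeff Finset.univ fun j => h (σ j) j).2]
    rfl

theorem X_pow_mul_wronskianMinor {R : Type*} [CommRing R] {n : ℕ} (q : Fin n → Polynomial R)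
    (r : Fin n → ℕ) : Polynomial.X ^ (∑ i, r i) * wronskianMinor q r =
      (Matrix.of fun i j => Polynomial.X ^ r i * Polynomial.derivative^[r i] (q j)).det := by
  rw [wronskianMinor, ← Finset.prod_pow_eq_pow_sum]
  exact (Matrix.det_mul_column _ _).symm

theorem natDegree_X_pow_mul_iterate_derivative_le {R : Type*} [CommRing R] (f : Polynomial R)
    (r : ℕ) : (Polynomial.X ^ r * Polynomial.derivative^[r] f).natDegree ≤ f.natDegree := by
  rw [Polynomial.natDegree_le_iff_coeff_eq_zero]
  intro N hN
  rw [Polynomial.coeff_X_pow_mul']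
  split_ifs with h
  · rw [Polynomial.coeff_iterate_derivative, Nat.sub_add_cancel h,
      Polynomial.coeff_eq_zero_of_natDegree_lt hN, smul_zero]
  · rfl

theorem coeff_X_pow_mul_iterate_derivative {R : Type*} [CommRing R] (f : Polynomial R)
    (r k : ℕ) : (Polynomial.X ^ r * Polynomial.derivative^[r] f).coeff k =
      f.coeff k * (k.descFactorial r : R) := by
  rw [Polynomial.coeff_X_pow_mul']
  split_ifs with h
  · rw [Polynomial.coeff_iterate_derivative, Nat.sub_add_cancel h, nsmul_eq_mul, mul_comm]
  · rw [Nat.descFactorial_of_lt (not_le.1 h), Nat.cast_zero, mul_zero]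

theorem X_pow_mul_wronskianMinor_natDegree_le_and_coeff {R : Type*} [CommRing R] {n : ℕ}
    (q : Fin n → Polynomial R) (r : Fin n → ℕ) :
    (Polynomial.X ^ (∑ i, r i) * wronskianMinor q r).natDegree ≤ ∑ j, (q j).natDegree ∧
    (Polynomial.X ^ (∑ i, r i) * wronskianMinor q r).coeff (∑ j, (q j).natDegree) =
      (Matrix.of fun i j =>
        (q j).coeff (q j).natDegree * ((q j).natDegree.descFactorial (r i) : R)).det := by
  rw [X_pow_mul_wronskianMinor]
  have h := natDegree_det_le_and_coeff (d := fun j => (q j).natDegree)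
    (M := Matrix.of fun i j => Polynomial.X ^ r i * Polynomial.derivative^[r i] (q j))
    fun i j => natDegree_X_pow_mul_iterate_derivative_le (q j) (r i)
  simpa only [Matrix.of_apply, coeff_X_pow_mul_iterate_derivative] using h

theorem natDegree_wronskianMinor_le {K : Type*} [Field K] {n : ℕ} {q : Fin n → Polynomial K}
    {r : Fin n → ℕ}
    (h : wronskianMinor q r ≠ 0) :
    (wronskianMinor q r).natDegree + ∑ i, r i ≤ ∑ j, (q j).natDegree := by
  have := (X_pow_mul_wronskianMinor_natDegree_le_and_coeff q r).1
  rw [Polynomial.natDegree_mul (pow_ne_zero _ Polynomial.X_ne_zero) h,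
    Polynomial.natDegree_X_pow] at this
  omega

theorem det_descFactorial_ne_zero (K : Type*) [Field K] [CharZero K] {n : ℕ} {d : Fin n → ℕ}
    (hd : Function.Injective d) :
    (Matrix.of fun i j : Fin n => ((d j).descFactorial i : K)).det ≠ 0 := by
  have h := Matrix.det_eval_matrixOfPolynomials_eq_det_vandermonde (fun j => (d j : K))
    (fun i : Fin n => descPochhammer K i) (fun i => descPochhammer_natDegree K i)
    (fun i => monic_descPochhammer K i)
  rw [← Matrix.det_transpose]
  have h2 : (Matrix.of fun i j : Fin n => ((d j).descFactorial i : K)).transpose =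
      Matrix.of fun i j : Fin n => (descPochhammer K j).eval (d i : K) := by
    ext i j
    simp [descPochhammer_eval_eq_descFactorial]
  rw [h2, ← h, Matrix.det_vandermonde_ne_zero_iff]
  exact Nat.cast_injective.comp hd

theorem natDegree_wronskianMinor {K : Type*} [Field K] [CharZero K] {n : ℕ}
    {q : Fin n → Polynomial K} (hq : ∀ j, q j ≠ 0)
    (hd : Function.Injective fun j => (q j).natDegree) :
    wronskianMinor q (fun i => i) ≠ 0 ∧
    (wronskianMinor q fun i => i).natDegree + ∑ i : Fin n, (i : ℕ) = ∑ j, (q j).natDegree := by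
  have h := X_pow_mul_wronskianMinor_natDegree_le_and_coeff q fun i => i
  have hne : (Polynomial.X ^ (∑ i : Fin n, (i : ℕ)) *
      wronskianMinor q fun i => i).coeff (∑ j, (q j).natDegree) ≠ 0 := by
    rw [h.2]
    have := Matrix.det_mul_row (fun j => (q j).coeff (q j).natDegree)
      (Matrix.of fun i j : Fin n => (((q j).natDegree).descFactorial i : K))
    simp only [Matrix.of_apply] at this
    rw [this]
    refine mul_ne_zero (Finset.prod_ne_zero_iff.2 fun j _ => ?_) (det_descFactorial_ne_zero K hd)
    exact Polynomial.leadingCoeff_ne_zero.2 (hq j)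
  have hW : (wronskianMinor q fun i => i) ≠ 0 := by
    intro h0
    rw [h0, mul_zero, Polynomial.coeff_zero] at hne
    exact hne rfl
  refine ⟨hW, le_antisymm (natDegree_wronskianMinor_le hW) ?_⟩
  have := Polynomial.le_natDegree_of_ne_zero hne
  rwa [Polynomial.natDegree_mul (pow_ne_zero _ Polynomial.X_ne_zero) hW,
    Polynomial.natDegree_X_pow, add_comm] at this

theorem exists_matrix_of_span_eq {K : Type*} [Field K] {n : ℕ} {p q : Fin n → Polynomial K}
    (h : Submodule.span K (Set.range p) = Submodule.span K (Set.range q)) :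
    ∃ c : Matrix (Fin n) (Fin n) K, ∀ j, q j = ∑ i, c i j • p i := by
  have : ∀ j, ∃ c : Fin n → K, ∑ i, c i • p i = q j := fun j => by
    rw [← Submodule.mem_span_range_iff_exists_fun, h]
    exact Submodule.subset_span ⟨j, rfl⟩
  choose c hc using this
  exact ⟨Matrix.of fun i j => c j i, fun j => (hc j).symm⟩

theorem linearIndependent_of_wronskianMinor_ne_zero {K : Type*} [Field K] {n : ℕ}
    {p : Fin n → Polynomial K} {r : Fin n → ℕ} (h : wronskianMinor p r ≠ 0) :
    LinearIndependent K p := by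
  rw [Fintype.linearIndependent_iff]
  intro c hc j
  by_contra hj
  rw [wronskianMinor] at h
  refine h (Matrix.exists_mulVec_eq_zero_iff.1 ⟨fun j => Polynomial.C (c j), fun h0 => ?_, ?_⟩)
  · exact hj (by simpa using congrFun h0 j)
  · ext1 i
    have := congrArg (Polynomial.derivative^[r i]) hc
    rw [Polynomial.iterate_derivative_sum, Polynomial.iterate_derivative_zero] at this
    simp only [Polynomial.smul_eq_C_mul, Polynomial.iterate_derivative_C_mul] at this
    simpa [Matrix.mulVec, dotProduct, mul_comm] using this

theorem exists_span_eq_injective_natDegree {K : Type*} [Field K] {n : ℕ} {p : Fin n → Polynomial K}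
    (hp : LinearIndependent K p) :
    ∃ q : Fin n → Polynomial K, Submodule.span K (Set.range p) = Submodule.span K (Set.range q) ∧
      (∀ j, q j ≠ 0) ∧ Function.Injective fun j => (q j).natDegree := by
  have hne : ∀ q : Fin n → Polynomial K,
      Submodule.span K (Set.range p) = Submodule.span K (Set.range q) → ∀ j, q j ≠ 0 := by
    intro q hq
    rw [linearIndependent_iff_card_eq_finrank_span, Set.finrank, hq] at hp
    exact (linearIndependent_iff_card_eq_finrank_span.2 hp).ne_zero
  obtain ⟨q, hq, hmin⟩ := exists_minimalFor_of_wellFoundedLT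
    (fun q : Fin n → Polynomial K =>
      Submodule.span K (Set.range p) = Submodule.span K (Set.range q))
    (fun q => ∑ j, (q j).natDegree) ⟨p, rfl⟩
  refine ⟨q, hq, hne q hq, ?_⟩
  intro a b hab
  by_contra hne'
  dsimp only at hab
  set t := (q a).leadingCoeff / (q b).leadingCoeff with ht
  have hb : (q b).leadingCoeff ≠ 0 := Polynomial.leadingCoeff_ne_zero.2 (hne q hq b)
  have ha : (q a).leadingCoeff ≠ 0 := Polynomial.leadingCoeff_ne_zero.2 (hne q hq a)
  have ht0 : t ≠ 0 := div_ne_zero ha hb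
  set q' := Function.update q a (q a - t • q b) with hq'
  have hspan : Submodule.span K (Set.range q) = Submodule.span K (Set.range q') := by
    have hb' : q' b = q b := Function.update_of_ne (Ne.symm hne') _ _
    have ha' : q' a = q a - t • q b := Function.update_self _ _ _
    apply le_antisymm <;> rw [Submodule.span_le] <;> rintro _ ⟨j, rfl⟩
    · rcases eq_or_ne j a with rfl | hj
      · have : q j = q' j + t • q' b := by rw [ha', hb', sub_add_cancel]
        rw [this]
        exact add_mem (Submodule.subset_span ⟨_, rfl⟩)
          (Submodule.smul_mem _ _ (Submodule.subset_span ⟨_, rfl⟩))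
      · exact Submodule.subset_span ⟨j, Function.update_of_ne hj _ _⟩
    · rcases eq_or_ne j a with rfl | hj
      · rw [ha']
        exact sub_mem (Submodule.subset_span ⟨_, rfl⟩)
          (Submodule.smul_mem _ _ (Submodule.subset_span ⟨_, rfl⟩))
      · exact Submodule.subset_span ⟨j, (Function.update_of_ne hj _ _).symm⟩
  have hlt : (q' a).natDegree < (q a).natDegree := by
    have hne2 := hne q' (hq.trans hspan) a
    have ha' : q' a = q a - t • q b := Function.update_self _ _ _
    have hdeg : (q a).degree = (t • q b).degree := by
      rw [Polynomial.degree_smul_of_smul_regular _ (IsRegular.of_ne_zero ht0).left.isSMulRegular]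
      rw [Polynomial.degree_eq_natDegree (hne q hq a), Polynomial.degree_eq_natDegree (hne q hq b),
        hab]
    refine Polynomial.natDegree_lt_natDegree hne2 ?_
    rw [ha']
    refine Polynomial.degree_sub_lt_left hdeg (hne q hq a) ?_
    rw [Polynomial.smul_eq_C_mul, Polynomial.leadingCoeff_mul, Polynomial.leadingCoeff_C, ht,
      div_mul_cancel₀ _ hb]
  have hsum : ∑ j, (q' j).natDegree < ∑ j, (q j).natDegree := by
    refine Finset.sum_lt_sum (fun j _ => ?_) ⟨a, Finset.mem_univ a, hlt⟩
    rcases eq_or_ne j a with rfl | hj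
    · exact hlt.le
    · rw [hq', Function.update_of_ne hj]
  exact absurd (hmin (hq.trans hspan) hsum.le) (not_le.2 hsum)

theorem wronskianMinor_ne_zero {K : Type*} [Field K] [CharZero K] {n : ℕ}
    {p : Fin n → Polynomial K} (hp : LinearIndependent K p) :
    (wronskianMinor p fun i => i) ≠ 0 := by
  obtain ⟨q, hq, hq0, hqd⟩ := exists_span_eq_injective_natDegree hp
  obtain ⟨c, hc⟩ := exists_matrix_of_span_eq hq
  have := (natDegree_wronskianMinor hq0 hqd).1
  rw [wronskianMinor_sum_smul p q c hc] at this
  exact left_ne_zero_of_mul this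

theorem degree_wronskianCoeff_lt {n k : ℕ} {p : Fin n → Polynomial ℂ}
    (hp : (wronskianMinor p fun i => i) ≠ 0) (hk : k < n) :
    (wronskianCoeff p k).degree < (wronskianMinor p fun i => i).degree := by
  obtain ⟨q, hq, hq0, hqd⟩ := exists_span_eq_injective_natDegree
    (linearIndependent_of_wronskianMinor_ne_zero hp)
  obtain ⟨c, hc⟩ := exists_matrix_of_span_eq hq.symm
  have hpq := wronskianMinor_sum_smul q p c hc
  rw [hpq] at hp
  have hc0 : Polynomial.C c.det ≠ 0 := right_ne_zero_of_mul hp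
  rw [wronskianCoeff, hpq, hpq]
  have hsign : ((-1) ^ k : Polynomial ℂ).degree = 0 := by
    rw [Polynomial.degree_pow]; simp
  rw [Polynomial.degree_mul, hsign, zero_add, Polynomial.degree_mul, Polynomial.degree_mul,
    Polynomial.degree_C (by simpa using hc0), add_zero, add_zero]
  have h1 := natDegree_wronskianMinor hq0 hqd
  rcases eq_or_ne (wronskianMinor q fun i => skipAt k i) 0 with h0 | h0
  · rw [h0, Polynomial.degree_zero, bot_lt_iff_ne_bot]
    exact Polynomial.degree_ne_bot.2 h1.1
  · have h2 := natDegree_wronskianMinor_le h0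
    refine Polynomial.degree_lt_degree ?_
    have h3 : ∑ i : Fin n, (i : ℕ) < ∑ i : Fin n, skipAt k i := by
      refine Finset.sum_lt_sum (fun i _ => ?_) ⟨⟨k, hk⟩, Finset.mem_univ _, ?_⟩
      · unfold skipAt; split_ifs <;> omega
      · simp [skipAt]
    omega

theorem eq_zero_of_sum_mul_eval_eq_zero {n : ℕ} {p : Fin n → Polynomial ℂ} {x : ℂ} {k₀ : ℕ}
    (hk₀ : k₀ ≤ n) (h : (wronskianMinor p fun i => skipAt k₀ i).eval x ≠ 0) {v : ℕ → ℂ}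
    (hv₀ : v k₀ = 0) (hv : ∀ j, ∑ k ∈ Finset.range (n + 1),
      v k * (Polynomial.derivative^[k] (p j)).eval x = 0) : ∀ k ≤ n, v k = 0 := by
  have hdet : (Matrix.of fun i j : Fin n =>
      (Polynomial.derivative^[skipAt k₀ i] (p j)).eval x).det ≠ 0 := by
    have := RingHom.map_det (Polynomial.evalRingHom x)
      (Matrix.of fun i j : Fin n => Polynomial.derivative^[skipAt k₀ i] (p j))
    rw [Polynomial.coe_evalRingHom] at this
    rw [wronskianMinor, this] at h
    exact h
  have hskip : ∀ i : Fin n,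
      (((⟨k₀, Nat.lt_succ_of_le hk₀⟩ : Fin (n + 1)).succAbove i : Fin (n + 1)) : ℕ) =
        skipAt k₀ i := fun i => by
    simp only [skipAt, Fin.succAbove, Fin.lt_def, Fin.val_castSucc]
    split_ifs <;> simp
  have hzero := Matrix.eq_zero_of_vecMul_eq_zero (v := fun i : Fin n => v (skipAt k₀ i)) hdet (by
    ext1 j
    have := hv j
    rw [Finset.sum_range, Fin.sum_univ_succAbove _ ⟨k₀, Nat.lt_succ_of_le hk₀⟩] at this
    simp only [hskip, hv₀, zero_mul, zero_add] at this
    exact this)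
  intro k hk
  rcases lt_trichotomy k k₀ with hlt | rfl | hlt
  · have := congrFun hzero ⟨k, by omega⟩
    simpa [skipAt, hlt] using this
  · exact hv₀
  · have := congrFun hzero ⟨k - 1, by omega⟩
    have h1 : ¬ k - 1 < k₀ := by omega
    have h2 : k - 1 + 1 = k := by omega
    simpa [skipAt, h1, h2] using this

theorem exists_eigenvalue_of_simple_root {m : ℕ} {p : Fin (m + 1) → Polynomial ℂ} {x : ℂ}
    (hx : (wronskianMinor p fun i => i).eval x = 0)
    (hx' : (Polynomial.derivative (wronskianMinor p fun i => i)).eval x ≠ 0) :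
    ∃ y : ℂ, (Polynomial.derivative (wronskianCoeff p 0)).eval x = y * (wronskianCoeff p 0).eval x ∧
      ∀ k ≤ m, (Polynomial.derivative (wronskianCoeff p (k + 1))).eval x +
        (wronskianCoeff p k).eval x = y * (wronskianCoeff p (k + 1)).eval x := by
  rw [derivative_wronskianMinor] at hx'
  have ha : (wronskianCoeff p m).eval x ≠ 0 := by
    rw [wronskianCoeff, Polynomial.eval_mul]
    exact mul_ne_zero (by simp) hx'
  have hlast : (wronskianCoeff p (m + 1)).eval x = 0 := by
    rw [wronskianCoeff_self, Polynomial.eval_mul, hx, mul_zero]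
  set b : ℕ → ℂ := fun k => (Polynomial.derivative (wronskianCoeff p k)).eval x +
    Nat.casesOn k 0 fun l => (wronskianCoeff p l).eval x with hb
  set y := b m / (wronskianCoeff p m).eval x with hy
  have hb_sum : ∀ j, ∑ k ∈ Finset.range (m + 2),
      b k * (Polynomial.derivative^[k] (p j)).eval x = 0 := by
    intro j
    have h := congrArg (fun f => (Polynomial.derivative f).eval x) (sum_wronskianCoeff_mul_self p j)
    simp only [Polynomial.derivative_sum, Polynomial.derivative_mul, Polynomial.eval_finsetSum,
      Polynomial.eval_add, Polynomial.eval_mul, Finset.sum_add_distrib,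
      ← Function.iterate_succ_apply' (f := Polynomial.derivative), Polynomial.derivative_zero,
      Polynomial.eval_zero] at h
    rw [← h]
    simp only [hb, add_mul, Finset.sum_add_distrib]
    congr 1
    rw [Finset.sum_range_succ', Finset.sum_range_succ _ (m + 1), hlast]
    simp
  have hzero := eq_zero_of_sum_mul_eval_eq_zero (Nat.le_succ m) hx'
    (v := fun k => b k - y * (wronskianCoeff p k).eval x)
    (by rw [hy, div_mul_cancel₀ _ ha, sub_self]) (by
      intro j
      have h := congrArg (fun f => f.eval x) (sum_wronskianCoeff_mul_self p j)
      simp only [Polynomial.eval_finsetSum, Polynomial.eval_mul, Polynomial.eval_zero] at h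
      simp only [sub_mul, Finset.sum_sub_distrib, hb_sum, mul_assoc, ← Finset.mul_sum, h,
        mul_zero, sub_zero])
  refine ⟨y, ?_, fun k hk => ?_⟩
  · have := hzero 0 (by omega)
    simpa [hb, sub_eq_zero] using this
  · have := hzero (k + 1) (by omega)
    simpa [hb, sub_eq_zero] using this

theorem exists_derivative_eval_eq {ι : Type*} [Fintype ι] [DecidableEq ι] {z : ι → ℂ}
    (hz : Function.Injective z) :
    ∃ r : ι → ℂ, ∀ f : Polynomial ℂ, f.degree < Fintype.card ι → ∀ i,
      (Polynomial.derivative f).eval (z i) / ∏ j ∈ Finset.univ.erase i, (z i - z j) =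
        r i * (f.eval (z i) / ∏ j ∈ Finset.univ.erase i, (z i - z j)) +
          ∑ j, (z i - z j)⁻¹ * (f.eval (z j) / ∏ l ∈ Finset.univ.erase j, (z j - z l)) := by
  set w : ι → ℂ := fun i => ∏ j ∈ Finset.univ.erase i, (z i - z j) with hw
  have hw0 : ∀ i, w i ≠ 0 := fun i => Finset.prod_ne_zero_iff.2 fun j hj =>
    sub_ne_zero.2 (hz.ne (Finset.ne_of_mem_erase hj).symm)
  set P : ι → Polynomial ℂ := fun i => ∏ j ∈ Finset.univ.erase i,
    (Polynomial.X - Polynomial.C (z j)) with hP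
  have hPeval : ∀ i j, (P i).eval (z j) = if i = j then w j else 0 := by
    intro i j
    split_ifs with h
    · subst h; simp [hP, hw, Polynomial.eval_prod]
    · rw [hP, Polynomial.eval_prod]
      refine Finset.prod_eq_zero (Finset.mem_erase.2 ⟨Ne.symm h, Finset.mem_univ j⟩) ?_
      simp
  have hPdeg : ∀ i, (P i).degree < Fintype.card ι := by
    intro i
    rw [hP, Polynomial.degree_prod]
    simp only [Polynomial.degree_X_sub_C, Finset.sum_const, Finset.card_erase_of_mem
      (Finset.mem_univ i), Finset.card_univ, nsmul_eq_mul, mul_one]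
    have : 0 < Fintype.card ι := Fintype.card_pos_iff.2 ⟨i⟩
    exact_mod_cast Nat.sub_lt this one_pos
  have hPder : ∀ i j, j ≠ i → (Polynomial.derivative (P j)).eval (z i) = (z i - z j)⁻¹ * w i := by
    intro i j hji
    have hmem : i ∈ Finset.univ.erase j := Finset.mem_erase.2 ⟨hji.symm, Finset.mem_univ i⟩
    have hmem' : j ∈ Finset.univ.erase i := Finset.mem_erase.2 ⟨hji, Finset.mem_univ j⟩
    have h1 : P j = (Polynomial.X - Polynomial.C (z i)) *
        ∏ l ∈ (Finset.univ.erase j).erase i, (Polynomial.X - Polynomial.C (z l)) :=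
      (Finset.mul_prod_erase _ _ hmem).symm
    have h2 : w i = (z i - z j) * ∏ l ∈ (Finset.univ.erase i).erase j, (z i - z l) :=
      (Finset.mul_prod_erase _ _ hmem').symm
    rw [h1, h2, inv_mul_cancel_left₀ (sub_ne_zero.2 (hz.ne hji.symm))]
    simp [Polynomial.eval_prod, Finset.erase_right_comm]
  refine ⟨fun i => (Polynomial.derivative (P i)).eval (z i) / w i, fun f hf i => ?_⟩
  have hexp : f = ∑ j, Polynomial.C (f.eval (z j) / w j) * P j := by
    refine Polynomial.eq_of_degrees_lt_of_eval_index_eq Finset.univ hz.injOn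
      (by rwa [Finset.card_univ]) ?_ fun i _ => ?_
    · refine (Polynomial.degree_sum_le _ _).trans_lt ?_
      rw [Finset.sup_lt_iff (by exact bot_lt_iff_ne_bot.2 (by simp))]
      intro j _
      rw [Finset.card_univ]
      rw [← Polynomial.smul_eq_C_mul]
      exact (Polynomial.degree_smul_le _ _).trans_lt (hPdeg j)
    · rw [Polynomial.eval_finsetSum]
      simp [hPeval, hw0]
  have hder : (Polynomial.derivative f).eval (z i) =
      ∑ j, f.eval (z j) / w j * (Polynomial.derivative (P j)).eval (z i) := by
    conv_lhs => rw [hexp]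
    simp [Polynomial.eval_finsetSum]
  rw [hder, ← Finset.add_sum_erase _ _ (Finset.mem_univ i),
    ← Finset.add_sum_erase _ (fun j => (z i - z j)⁻¹ * (f.eval (z j) / w j)) (Finset.mem_univ i),
    sub_self, inv_zero, zero_mul, zero_add, add_div, Finset.sum_div]
  congr 1
  · ring
  · refine Finset.sum_congr rfl fun j hj => ?_
    rw [hPder i j (Finset.ne_of_mem_erase hj), mul_comm, mul_assoc, mul_div_assoc]
    congr 1
    exact mul_div_cancel_left₀ _ (hw0 i)

theorem isNilpotent_of_trace_pow_eq_zero {ι : Type*} [Fintype ι] [DecidableEq ι]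
    {M : Matrix ι ι ℂ} {N : ℕ} (h : ∀ k ≥ N, (M ^ k).trace = 0) : IsNilpotent M := by
  obtain ⟨q, hq, hndvd⟩ := Polynomial.exists_eq_pow_rootMultiplicity_mul_and_not_dvd M.charpoly
    M.charpoly_monic.ne_zero 0
  set m := M.charpoly.rootMultiplicity 0
  rw [Polynomial.C_0, sub_zero] at hq hndvd
  have hcop : IsCoprime (Polynomial.X ^ (m + N)) q :=
    ((Polynomial.irreducible_X.coprime_iff_not_dvd).2 hndvd).pow_left
  obtain ⟨a, b, hab⟩ := hcop
  set E := Polynomial.aeval M (a * Polynomial.X ^ (m + N)) with hE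
  have hch : Polynomial.aeval M (Polynomial.X ^ m * q) = 0 := by
    rw [← hq]; exact M.aeval_self_charpoly
  have hidem : E * E = E := by
    have h1 : a * Polynomial.X ^ (m + N) * (a * Polynomial.X ^ (m + N)) =
        a * Polynomial.X ^ (m + N) -
          a * b * Polynomial.X ^ N * (Polynomial.X ^ m * q) := by
      linear_combination (a * Polynomial.X ^ (m + N)) * hab
    rw [hE, ← map_mul, h1, map_sub, map_mul _ (a * b * _), hch, mul_zero, sub_zero]
  have htr : E.trace = 0 := by
    rw [hE, Polynomial.aeval_eq_sum_range, Matrix.trace_sum]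
    refine Finset.sum_eq_zero fun k _ => ?_
    rw [Matrix.trace_smul, Polynomial.coeff_mul_X_pow']
    split_ifs with hk
    · rw [h k (by omega), smul_zero]
    · rw [zero_smul]
  have hE0 : E = 0 := by
    have h2 : IsIdempotentElem (Matrix.toLin' E) := by
      rw [IsIdempotentElem, Module.End.mul_eq_comp, ← Matrix.toLin'_mul, hidem]
    have h3 := LinearMap.IsIdempotentElem.eq_zero_of_trace_eq_zero h2
      (by rw [Matrix.trace_toLin'_eq, htr])
    simpa using h3
  refine ⟨m + N, ?_⟩
  have h4 : Polynomial.X ^ (m + N) = Polynomial.X ^ (m + N) * (a * Polynomial.X ^ (m + N)) +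
      b * Polynomial.X ^ N * (Polynomial.X ^ m * q) := by
    linear_combination -(Polynomial.X ^ (m + N)) * hab
  have h5 := congrArg (Polynomial.aeval M) h4
  rwa [map_add, map_mul, map_mul _ (b * _), hch, ← hE, hE0, mul_zero, mul_zero, add_zero, map_pow,
    Polynomial.aeval_X] at h5

/-- Complex conjugation of the coefficients of a polynomial. -/
noncomputable abbrev polyConj : Polynomial ℂ →+* Polynomial ℂ :=
  Polynomial.mapRingHom (starRingEnd ℂ)

theorem exists_real_wronskianCoeff_eval {m : ℕ} {p : Fin (m + 1) → Polynomial ℂ} {ι : Type*}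
    [Fintype ι] [DecidableEq ι] {z : ι → ℂ} (hz : Function.Injective z)
    (hzr : ∀ i, (z i).im = 0) {a : ℂ} (ha : a ≠ 0)
    (hW : (wronskianMinor p fun i => i) =
      Polynomial.C a * ∏ i, (Polynomial.X - Polynomial.C (z i))) :
    ∀ k ≤ m, ∀ i, ∃ t : ℝ, (wronskianCoeff p k).eval (z i) = a * t := by
  classical
  set w : ι → ℂ := fun i => ∏ j ∈ Finset.univ.erase i, (z i - z j) with hw
  have hw0 : ∀ i, w i ≠ 0 := fun i => Finset.prod_ne_zero_iff.2 fun j hj =>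
    sub_ne_zero.2 (hz.ne (Finset.ne_of_mem_erase hj).symm)
  have hWdeg : (wronskianMinor p fun i => i).degree = Fintype.card ι := by
    rw [hW, Polynomial.degree_C_mul ha, Polynomial.degree_prod]
    simp
  have hW0 : (wronskianMinor p fun i => i) ≠ 0 := by
    intro h; rw [h] at hWdeg; simp at hWdeg
  have hroot : ∀ i, (wronskianMinor p fun i => i).eval (z i) = 0 := fun i => by
    rw [hW, Polynomial.eval_mul, Polynomial.eval_prod, Finset.prod_eq_zero (Finset.mem_univ i)]
    · simp
    · simp
  have hder : ∀ i, (Polynomial.derivative (wronskianMinor p fun i => i)).eval (z i) = a * w i := by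
    intro i
    rw [hW, ← Finset.mul_prod_erase _ _ (Finset.mem_univ i)]
    simp [Polynomial.eval_prod, hw]
  have hy := fun i => exists_eigenvalue_of_simple_root (hroot i)
    (by rw [hder]; exact mul_ne_zero ha (hw0 i))
  choose y hy0 hy using hy
  obtain ⟨r, hr⟩ := exists_derivative_eval_eq hz
  set Y := calogeroMoser z (fun i => y i - r i) with hY
  have hYapp : ∀ (v : ι → ℂ) i, (Y.mulVec v) i =
      (y i - r i) * v i - ∑ j, (z i - z j)⁻¹ * v j := by
    intro v i
    rw [hY, calogeroMoser, Matrix.sub_mulVec, Pi.sub_apply, Matrix.mulVec_diagonal]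
    simp [Matrix.mulVec, dotProduct]
  set g : ℕ → ι → ℂ := fun k i => (wronskianCoeff p k).eval (z i) / w i with hg
  have hgder : ∀ k ≤ m, ∀ i, (Polynomial.derivative (wronskianCoeff p k)).eval (z i) / w i =
      r i * g k i + ∑ j, (z i - z j)⁻¹ * g k j := by
    intro k hk i
    exact hr _ (hWdeg ▸ degree_wronskianCoeff_lt hW0 (by omega)) i
  have hY0 : Y.mulVec (g 0) = 0 := by
    ext1 i
    have h1 := hgder 0 (by omega) i
    rw [hy0, mul_div_assoc] at h1
    rw [hYapp, Pi.zero_apply]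
    have h2 : g 0 i = (wronskianCoeff p 0).eval (z i) / w i := rfl
    rw [← h2] at h1
    linear_combination h1
  have hYk : ∀ k < m, Y.mulVec (g (k + 1)) = g k := by
    intro k hk
    ext1 i
    have h1 := hgder (k + 1) (by omega) i
    rw [eq_sub_of_add_eq (hy i k hk.le), sub_div, mul_div_assoc] at h1
    rw [hYapp]
    have h2 : g (k + 1) i = (wronskianCoeff p (k + 1)).eval (z i) / w i := rfl
    have h3 : g k i = (wronskianCoeff p k).eval (z i) / w i := rfl
    rw [← h2, ← h3] at h1
    linear_combination h1
  have hgm : g m = fun _ => (-1) ^ m * a := by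
    ext1 i
    have h1 := hy i m le_rfl
    rw [wronskianCoeff_self] at h1
    simp only [Polynomial.eval_mul, hroot, mul_zero] at h1
    have h2 : Polynomial.derivative ((-1) ^ (m + 1) * wronskianMinor p fun i => i) =
        (-1) ^ (m + 1) * Polynomial.derivative (wronskianMinor p fun i => i) := by
      have : ((-1 : Polynomial ℂ) ^ (m + 1)) = Polynomial.C ((-1) ^ (m + 1)) := by simp
      rw [this, Polynomial.derivative_C_mul]
    rw [h2, Polynomial.eval_mul, hder] at h1
    simp only [hg]
    rw [div_eq_iff (hw0 i)]
    simp only [Polynomial.eval_pow, Polynomial.eval_neg, Polynomial.eval_one] at h1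
    linear_combination h1
  have hpow : ∀ t ≤ m, (Y ^ t).mulVec (g m) = g (m - t) := by
    intro t
    induction t with
    | zero => intro _; simp
    | succ t ih =>
      intro ht
      rw [pow_succ', ← Matrix.mulVec_mulVec, ih (by omega)]
      have : m - t = (m - (t + 1)) + 1 := by omega
      rw [this, hYk _ (by omega)]
  have hpow0 : ∀ k ≥ m + 1, (Y ^ k).mulVec (g m) = 0 := by
    intro k hk
    obtain ⟨l, rfl⟩ := Nat.exists_eq_add_of_le hk
    rw [show m + 1 + l = l + (1 + m) by ring, pow_add, pow_add, pow_one, ← Matrix.mulVec_mulVec,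
      ← Matrix.mulVec_mulVec, hpow m le_rfl, Nat.sub_self, hY0, Matrix.mulVec_zero]
  have hc0 : ((-1) ^ m * a : ℂ) ≠ 0 := mul_ne_zero (by simp) ha
  have hsum : ∀ (k : ℕ) i, ((Y ^ k).mulVec (g m)) i = (∑ j, (Y ^ k) i j) * ((-1) ^ m * a) := by
    intro k i
    rw [hgm, Finset.sum_mul]
    rfl
  have htr : ∀ k ≥ m + 1, (Y ^ k).trace = 0 := by
    intro k hk
    rw [hY, trace_calogeroMoser_pow hz, ← hY]
    refine Finset.sum_eq_zero fun i _ => ?_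
    have h1 := congrFun (hpow0 k hk) i
    rw [hsum, Pi.zero_apply] at h1
    exact (mul_eq_zero.1 h1).resolve_right hc0
  have hnil := isNilpotent_of_trace_pow_eq_zero htr
  have hreal : ∀ i, (y i - r i).im = 0 := calogeroMoser_momenta_real hz hzr
    fun k => (Matrix.isNilpotent_trace_of_isNilpotent (hnil.pow_succ k)).eq_zero
  have hYreal : ∃ Z : Matrix ι ι ℝ, Y = Z.map (Complex.ofRealHom) := by
    refine ⟨Y.map Complex.re, Matrix.ext fun i j => ?_⟩
    have him : (Y i j).im = 0 := by
      simp only [hY, calogeroMoser, Matrix.sub_apply, Matrix.diagonal_apply, Matrix.of_apply,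
        Complex.sub_im]
      have h1 : ((z i - z j)⁻¹).im = 0 := by simp [Complex.inv_im, hzr]
      split_ifs <;> simp [h1, hreal]
    exact Complex.ext (by simp) (by simp [him])
  obtain ⟨Z, hZ⟩ := hYreal
  have hwreal : ∀ i, ∃ t : ℝ, w i = t := by
    intro i
    refine ⟨∏ j ∈ Finset.univ.erase i, ((z i).re - (z j).re), ?_⟩
    push_cast
    refine Finset.prod_congr rfl fun j _ => ?_
    refine Complex.ext (by simp) (by simp [hzr])
  intro k hk i
  obtain ⟨t, ht⟩ := hwreal i
  have h1 := congrFun (hpow (m - k) (by omega)) i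
  rw [hsum, show m - (m - k) = k by omega] at h1
  have h2 : (wronskianCoeff p k).eval (z i) = g k i * w i := by
    rw [hg, div_mul_cancel₀ _ (hw0 i)]
  refine ⟨(∑ j, (Z ^ (m - k)) i j) * (-1) ^ m * t, ?_⟩
  rw [h2, ← h1, ht, hZ, ← RingHom.mapMatrix_apply, ← map_pow]
  simp only [RingHom.mapMatrix_apply, Matrix.map_apply, Complex.ofRealHom_eq_coe]
  push_cast
  ring

theorem mem_span_of_sum_wronskianCoeff_mul_eq_zero {n : ℕ} {p : Fin n → Polynomial ℂ} {x : ℂ}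
    (hx : (wronskianMinor p fun i => i).eval x ≠ 0) {f : Polynomial ℂ}
    (hf : ∑ k ∈ Finset.range (n + 1), wronskianCoeff p k * Polynomial.derivative^[k] f = 0) :
    f ∈ Submodule.span ℂ (Set.range p) := by
  set J : Matrix (Fin n) (Fin n) ℂ :=
    Matrix.of fun i j => (Polynomial.derivative^[(i : ℕ)] (p j)).eval x with hJ
  have hdet : J.det ≠ 0 := by
    have := RingHom.map_det (Polynomial.evalRingHom x)
      (Matrix.of fun i j : Fin n => Polynomial.derivative^[(i : ℕ)] (p j))
    rw [Polynomial.coe_evalRingHom] at this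
    rw [wronskianMinor, this] at hx
    exact hx
  set c := J⁻¹.mulVec fun i => (Polynomial.derivative^[(i : ℕ)] f).eval x with hc
  have hJc : J.mulVec c = fun i : Fin n => (Polynomial.derivative^[(i : ℕ)] f).eval x := by
    rw [hc, Matrix.mulVec_mulVec, Matrix.mul_nonsing_inv _ (isUnit_iff_ne_zero.2 hdet),
      Matrix.one_mulVec]
  set g := f - ∑ j, c j • p j with hg
  have hgder : ∀ k, Polynomial.derivative^[k] g =
      Polynomial.derivative^[k] f - ∑ j, c j • Polynomial.derivative^[k] (p j) := by
    intro k
    rw [hg, Polynomial.iterate_derivative_sub, Polynomial.iterate_derivative_sum]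
    simp only [Polynomial.iterate_derivative_smul]
  have hDg : ∑ k ∈ Finset.range (n + 1), wronskianCoeff p k * Polynomial.derivative^[k] g = 0 := by
    simp only [hgder, mul_sub, Finset.sum_sub_distrib, hf, Finset.mul_sum, mul_smul_comm]
    rw [Finset.sum_comm]
    simp only [← Finset.smul_sum, sum_wronskianCoeff_mul_self, smul_zero, Finset.sum_const_zero,
      sub_zero]
  have hjet : ∀ k < n, (Polynomial.derivative^[k] g).IsRoot x := by
    intro k hk
    have h1 := congrFun hJc ⟨k, hk⟩
    rw [Polynomial.IsRoot.def, hgder, Polynomial.eval_sub, ← h1, Polynomial.eval_finsetSum]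
    simp [hJ, Matrix.mulVec, dotProduct, mul_comm]
  have hg0 : g = 0 := by
    by_contra hne
    set μ := g.rootMultiplicity x with hμ
    have hdvd : (Polynomial.X - Polynomial.C x) ^ μ ∣ g := Polynomial.pow_rootMultiplicity_dvd g x
    have hnμ : n ≤ μ := by
      rcases Nat.eq_zero_or_pos n with h0 | hpos
      · omega
      · have := (Polynomial.lt_rootMultiplicity_iff_isRoot_iterate_derivative (n := n - 1) hne).2
          fun k hk => hjet k (by omega)
        omega
    have h1 : (Polynomial.X - Polynomial.C x) ^ (μ - n + 1) ∣
        wronskianCoeff p n * Polynomial.derivative^[n] g := by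
      rw [Finset.sum_range_succ, add_comm] at hDg
      rw [eq_neg_of_add_eq_zero_left hDg, dvd_neg]
      refine Finset.dvd_sum fun k hk => Dvd.dvd.mul_left ?_ _
      exact (pow_dvd_pow _ (by have := Finset.mem_range.1 hk; omega)).trans
        (Polynomial.pow_sub_dvd_iterate_derivative_of_pow_dvd k hdvd)
    have hcop : IsCoprime ((Polynomial.X - Polynomial.C x) ^ (μ - n + 1)) (wronskianCoeff p n) := by
      refine IsCoprime.pow_left ?_
      rw [(Polynomial.irreducible_X_sub_C x).coprime_iff_not_dvd, Polynomial.dvd_iff_isRoot,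
        wronskianCoeff_self, Polynomial.IsRoot.def, Polynomial.eval_mul]
      exact mul_ne_zero (by simp) hx
    have h2 := Polynomial.pow_sub_dvd_iterate_derivative_of_pow_dvd (μ - n)
      (hcop.dvd_of_dvd_mul_left h1)
    rw [← Function.iterate_add_apply, Nat.sub_add_cancel hnμ, Nat.add_sub_cancel_left, pow_one,
      Polynomial.dvd_iff_isRoot] at h2
    have h3 : μ < g.rootMultiplicity x :=
      (Polynomial.lt_rootMultiplicity_iff_isRoot_iterate_derivative hne).2 fun k hk => by
        rcases hk.lt_or_eq with hlt | rfl
        · exact Polynomial.isRoot_iterate_derivative_of_lt_rootMultiplicity hlt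
        · exact h2
    omega
  rw [sub_eq_zero.1 hg0]
  exact Submodule.sum_mem _ fun j _ => Submodule.smul_mem _ _ (Submodule.subset_span ⟨j, rfl⟩)

theorem polyConj_eval (f : Polynomial ℂ) {x : ℂ} (hx : x.im = 0) :
    (polyConj f).eval x = starRingEnd ℂ (f.eval x) := by
  have h1 : starRingEnd ℂ x = x := Complex.conj_eq_iff_im.2 hx
  conv_lhs => rw [← h1]
  rw [polyConj, Polynomial.coe_mapRingHom, Polynomial.eval_map, Polynomial.eval₂_hom]

theorem polyConj_mem_span_of_simple_roots {n : ℕ} {p : Fin n → Polynomial ℂ} {ι : Type*}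
    [Fintype ι] {z : ι → ℂ} (hz : Function.Injective z)
    (hzr : ∀ i, (z i).im = 0) {a : ℂ} (ha : a ≠ 0)
    (hW : (wronskianMinor p fun i => i) =
      Polynomial.C a * ∏ i, (Polynomial.X - Polynomial.C (z i))) (j : Fin n) :
    polyConj (p j) ∈ Submodule.span ℂ (Set.range p) := by
  classical
  obtain _ | m := n
  · exact j.elim0
  have hW0 : (wronskianMinor p fun i => i) ≠ 0 := by
    rw [hW]
    exact mul_ne_zero (by simpa using ha)
      (Finset.prod_ne_zero_iff.2 fun i _ => Polynomial.X_sub_C_ne_zero _)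
  have hdeg : (wronskianMinor p fun i => i).degree = Fintype.card ι := by
    rw [hW, Polynomial.degree_C_mul ha, Polynomial.degree_prod]
    simp
  have hA : ∀ k ≤ m + 1, polyConj (wronskianCoeff p k) =
      Polynomial.C (starRingEnd ℂ a / a) * wronskianCoeff p k := by
    intro k hk
    rcases hk.lt_or_eq with hlt | rfl
    · have hlt' := hdeg ▸ degree_wronskianCoeff_lt hW0 hlt
      refine Polynomial.eq_of_degrees_lt_of_eval_index_eq Finset.univ hz.injOn ?_ ?_ fun i _ => ?_
      · rw [Finset.card_univ]
        exact (Polynomial.degree_map_le).trans_lt hlt'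
      · rw [Finset.card_univ, ← Polynomial.smul_eq_C_mul]
        exact (Polynomial.degree_smul_le _ _).trans_lt hlt'
      · obtain ⟨t, ht⟩ := exists_real_wronskianCoeff_eval hz hzr ha hW k (by omega) i
        rw [polyConj_eval _ (hzr i), Polynomial.eval_mul, ht]
        simp
        field_simp
    · rw [wronskianCoeff_self, hW]
      simp only [map_mul, map_pow, map_neg, map_one, map_prod, map_sub]
      have h1 : ∀ i, polyConj (Polynomial.C (z i)) = Polynomial.C (z i) := fun i => by
        simp [Complex.conj_eq_iff_im.2 (hzr i)]
      have h2 : polyConj Polynomial.X = Polynomial.X := by simp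
      have h3 : polyConj (Polynomial.C a) =
          Polynomial.C (starRingEnd ℂ a / a) * Polynomial.C a := by
        rw [← Polynomial.C_mul, div_mul_cancel₀ _ ha]; simp
      simp only [h1, h2, h3]
      ring
  obtain ⟨x, hx⟩ : ∃ x, (wronskianMinor p fun i => i).eval x ≠ 0 := by
    by_contra! h
    exact hW0 (Polynomial.funext fun x => by simpa using h x)
  refine mem_span_of_sum_wronskianCoeff_mul_eq_zero hx ?_
  have h := congrArg polyConj (sum_wronskianCoeff_mul_self p j)
  rw [map_sum, map_zero] at h
  have h4 : Polynomial.C (starRingEnd ℂ a / a) * ∑ k ∈ Finset.range (m + 1 + 1),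
      wronskianCoeff p k * Polynomial.derivative^[k] (polyConj (p j)) = 0 := by
    rw [← h, Finset.mul_sum]
    refine Finset.sum_congr rfl fun k hk => ?_
    rw [map_mul, hA k (by have := Finset.mem_range.1 hk; omega), mul_assoc]
    congr 2
    rw [polyConj, Polynomial.coe_mapRingHom, Polynomial.iterate_derivative_map]
  refine (mul_eq_zero.1 h4).resolve_left ?_
  simpa using ha

theorem map_wronskianMinor {R S : Type*} [CommRing R] [CommRing S] (f : R →+* S) {n : ℕ}
    (p : Fin n → Polynomial R) (r : Fin n → ℕ) :
    (wronskianMinor p r).map f = wronskianMinor (fun j => (p j).map f) r := by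
  rw [wronskianMinor, ← Polynomial.coe_mapRingHom, RingHom.map_det, wronskianMinor]
  congr 1
  refine Matrix.ext fun i j => ?_
  simp [Polynomial.iterate_derivative_map]

/-- The reduced echelon family `Xʲ + ∑ k, x (j, k) Xⁿ⁺ᵏ`. -/
noncomputable def echelonFamily {R : Type*} [CommRing R] {n m : ℕ} (x : Fin n × Fin m → R)
    (j : Fin n) : Polynomial R :=
  Polynomial.X ^ (j : ℕ) + ∑ k : Fin m, Polynomial.C (x (j, k)) * Polynomial.X ^ (n + (k : ℕ))

theorem coeff_echelonFamily_castAdd {R : Type*} [CommRing R] {n m : ℕ} (x : Fin n × Fin m → R)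
    (i j : Fin n) : (echelonFamily x j).coeff i = if i = j then 1 else 0 := by
  simp only [echelonFamily, Polynomial.coeff_add, Polynomial.coeff_X_pow,
    Polynomial.finsetSum_coeff, Polynomial.coeff_C_mul, Fin.val_inj]
  rw [Finset.sum_eq_zero, add_zero]
  intro k _
  rw [if_neg (by have := i.2; omega), mul_zero]

theorem coeff_echelonFamily_natAdd {R : Type*} [CommRing R] {n m : ℕ} (x : Fin n × Fin m → R)
    (j : Fin n) (k : Fin m) : (echelonFamily x j).coeff (n + k) = x (j, k) := by
  simp only [echelonFamily, Polynomial.coeff_add, Polynomial.coeff_X_pow,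
    Polynomial.finsetSum_coeff, Polynomial.coeff_C_mul, add_right_inj, Fin.val_inj]
  rw [if_neg (by have := j.2; omega), zero_add]
  simp

theorem coeff_echelonFamily_of_le {R : Type*} [CommRing R] {n m : ℕ} (x : Fin n × Fin m → R)
    (j : Fin n) {e : ℕ} (he : n + m ≤ e) : (echelonFamily x j).coeff e = 0 := by
  simp only [echelonFamily, Polynomial.coeff_add, Polynomial.coeff_X_pow,
    Polynomial.finsetSum_coeff, Polynomial.coeff_C_mul]
  rw [if_neg (by have := j.2; omega), zero_add]
  exact Finset.sum_eq_zero fun k _ => by rw [if_neg (by have := k.2; omega), mul_zero]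

theorem map_echelonFamily {R S : Type*} [CommRing R] [CommRing S] (f : R →+* S) {n m : ℕ}
    (x : Fin n × Fin m → R) (j : Fin n) :
    (echelonFamily x j).map f = echelonFamily (fun i => f (x i)) j := by
  simp [echelonFamily, Polynomial.map_sum]

theorem coeff_zero_wronskianMinor {R : Type*} [CommRing R] {n : ℕ} (p : Fin n → Polynomial R) :
    (wronskianMinor p fun i => i).coeff 0 = (∏ i : Fin n, ((i : ℕ).factorial : R)) *
      (Matrix.of fun i j : Fin n => (p j).coeff i).det := by
  rw [Polynomial.coeff_zero_eq_eval_zero, wronskianMinor, ← Polynomial.coe_evalRingHom,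
    RingHom.map_det, ← Matrix.det_mul_column]
  congr 1
  refine Matrix.ext fun i j => ?_
  simp [← Polynomial.coeff_zero_eq_eval_zero, Polynomial.coeff_iterate_derivative,
    Nat.descFactorial_self]

theorem coeff_zero_wronskianMinor_echelonFamily {R : Type*} [CommRing R] {n m : ℕ}
    (x : Fin n × Fin m → R) : (wronskianMinor (echelonFamily x) fun i => i).coeff 0 =
      ∏ i : Fin n, ((i : ℕ).factorial : R) := by
  rw [coeff_zero_wronskianMinor]
  simp only [coeff_echelonFamily_castAdd]
  have : (Matrix.of fun i j : Fin n => if i = j then (1 : R) else 0) = 1 :=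
    Matrix.ext fun i j => by simp [Matrix.one_apply]
  rw [this, Matrix.det_one, mul_one]

theorem mem_valuationSubring_of_coeff_wronskianMinor_mem {K : Type*} [Field K] [CharZero K]
    {V : ValuationSubring K} (hV : ∀ k : ℕ, k ≠ 0 → (k : K)⁻¹ ∈ V) {n m : ℕ}
    {x : Fin n × Fin m → K}
    (hx : ∀ e, (wronskianMinor (echelonFamily x) fun i => i).coeff e ∈ V) (jk : Fin n × Fin m) :
    x jk ∈ V := by
  classical
  set b : Fin n → Fin (n + m) → K := fun j e => (echelonFamily x j).coeff e with hb
  set B : (Fin n → Fin (n + m)) → Matrix (Fin n) (Fin n) K :=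
    fun s => Matrix.of fun i j => b j (s i) with hB
  have : Nonempty (Fin n → Fin (n + m)) := ⟨Fin.castAdd m⟩
  obtain ⟨s, hs⟩ := Finite.exists_max fun s => V.valuation (B s).det
  have hone : B (Fin.castAdd m) = 1 := Matrix.ext fun i j => by
    simp [hB, hb, coeff_echelonFamily_castAdd, Matrix.one_apply]
  have hs1 : 1 ≤ V.valuation (B s).det := by
    have := hs (Fin.castAdd m)
    rwa [hone, Matrix.det_one, map_one] at this
  have hdet : (B s).det ≠ 0 := by
    intro h
    rw [h, map_zero] at hs1
    exact absurd hs1 (by simp)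
  have hupdate : ∀ (t : Fin n → Fin (n + m)) (i : Fin n) (e : Fin (n + m)),
      B (Function.update t i e) = (B t).updateRow i fun j => b j e := by
    intro t i e
    refine Matrix.ext fun i' j => ?_
    rw [Matrix.updateRow_apply]
    split_ifs with h
    · subst h; simp [hB]
    · simp [hB, Function.update_of_ne h]
  have hxdet : x jk = (B (Function.update (Fin.castAdd m) jk.1 (Fin.natAdd n jk.2))).det := by
    rw [hupdate, hone, ← Matrix.cramer_transpose_apply, Matrix.transpose_one, Matrix.cramer_one]
    simp [hb, coeff_echelonFamily_natAdd]
  suffices h : V.valuation (B s).det ≤ 1 by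
    rw [← V.valuation_le_one_iff, hxdet]
    exact (hs _).trans h
  by_contra! hgt
  set c : Matrix (Fin n) (Fin n) K := (B s)⁻¹ with hc
  set q : Fin n → Polynomial K := fun j => ∑ i, c i j • echelonFamily x i with hq
  have hqcoeff : ∀ j (e : Fin (n + m)), (q j).coeff e =
      (B (Function.update s j e)).det / (B s).det := by
    intro j e
    rw [hupdate, ← Matrix.cramer_transpose_apply, Matrix.cramer_eq_adjugate_mulVec, hq, hc,
      Matrix.inv_def, Ring.inverse_eq_inv', ← Matrix.adjugate_transpose]
    simp only [Polynomial.finsetSum_coeff, Polynomial.coeff_smul, Matrix.smul_apply, smul_eq_mul,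
      Matrix.mulVec, dotProduct, Finset.sum_div, Matrix.transpose_apply]
    refine Finset.sum_congr rfl fun i _ => ?_
    simp only [hb]
    ring
  have hqmem : ∀ j e, (q j).coeff e ∈ V := by
    intro j e
    by_cases he : e < n + m
    · have := hqcoeff j ⟨e, he⟩
      simp only at this
      rw [this, ← V.valuation_le_one_iff, map_div₀]
      exact div_le_one_of_le₀ (hs _) zero_le
    · simp only [hq, Polynomial.finsetSum_coeff, Polynomial.coeff_smul,
        coeff_echelonFamily_of_le x _ (not_lt.1 he), smul_zero, Finset.sum_const_zero]
      exact V.zero_mem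
  have hlift : ∀ j, ∃ f : Polynomial V, f.map V.subtype = q j := by
    intro j
    have := (Polynomial.lifts_iff_coeff_lifts (f := V.subtype) (q j)).2 fun e =>
      ⟨⟨_, hqmem j e⟩, rfl⟩
    exact (Polynomial.mem_lifts _).1 this
  choose f hf using hlift
  have hfcoeff : ∀ j e, ((f j).coeff e : K) = (q j).coeff e := fun j e => by
    rw [← hf, Polynomial.coeff_map]; rfl
  set κ := IsLocalRing.ResidueField V
  have : CharZero κ := by
    refine charZero_of_inj_zero fun k hk => ?_
    by_contra hk0
    have hunit : IsUnit (k : V) := by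
      refine IsUnit.of_mul_eq_one ⟨(k : K)⁻¹, hV k hk0⟩ (Subtype.ext ?_)
      simp [hk0]
    have := (IsLocalRing.residue_ne_zero_iff_isUnit (k : V)).2 hunit
    rw [map_natCast] at this
    exact this hk
  have hli : LinearIndependent κ fun j => (f j).map (IsLocalRing.residue V) := by
    rw [Fintype.linearIndependent_iff]
    intro d hd i
    have h1 := congrArg (fun g => g.coeff (s i)) hd
    have h2 : ∀ j, (f j).coeff (s i) = if i = j then 1 else 0 := by
      intro j
      refine Subtype.ext ?_
      rw [hfcoeff, hqcoeff, hupdate]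
      split_ifs with h
      · subst h
        have : (fun j => b j (s i)) = (B s) i := rfl
        rw [this, Matrix.updateRow_eq_self, div_self hdet]; rfl
      · rw [Matrix.det_zero_of_row_eq (i := j) (j := i) (Ne.symm h), zero_div]; · rfl
        rw [Matrix.updateRow_self, Matrix.updateRow_ne h]
        rfl
    simpa [Polynomial.finsetSum_coeff, h2, apply_ite (IsLocalRing.residue V)] using h1
  refine wronskianMinor_ne_zero hli ?_
  rw [← map_wronskianMinor]
  have hWq : (wronskianMinor f fun i => i).map V.subtype =
      (wronskianMinor (echelonFamily x) fun i => i) * Polynomial.C c.det := by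
    rw [map_wronskianMinor]
    exact wronskianMinor_sum_smul _ _ c hf _
  ext e
  rw [Polynomial.coeff_map, Polynomial.coeff_zero, IsLocalRing.residue_eq_zero_iff,
    ValuationSubring.valuation_lt_one_iff]
  have h3 := congrArg (fun g => g.coeff e) hWq
  simp only [Polynomial.coeff_map, Polynomial.coeff_mul_C] at h3
  have h4 : (((wronskianMinor f fun i => i).coeff e : V) : K) =
      (wronskianMinor (echelonFamily x) fun i => i).coeff e * c.det := h3
  rw [h4, map_mul, hc, Matrix.det_nonsing_inv, Ring.inverse_eq_inv', map_inv₀]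
  exact (mul_le_of_le_one_left' ((V.valuation_le_one_iff _).2 (hx e))).trans_lt
    (inv_lt_one_of_one_lt₀ hgt)

theorem MvPolynomial.aeval_injective_of_isIntegral {k σ ι : Type*} [Field k] [Finite σ] [Finite ι]
    (hcard : Nat.card ι = Nat.card σ) {w : ι → MvPolynomial σ k}
    (hw : (MvPolynomial.aeval w : MvPolynomial ι k →ₐ[k] MvPolynomial σ k).IsIntegral) :
    Function.Injective (MvPolynomial.aeval w : MvPolynomial ι k →ₐ[k] MvPolynomial σ k) := by
  have hint : Algebra.IsIntegral (Algebra.adjoin k (Set.range w)) (MvPolynomial σ k) := by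
    refine ⟨fun x => ?_⟩
    obtain ⟨P, hP, hPx⟩ := hw x
    have hmem : ∀ y, MvPolynomial.aeval w y ∈ Algebra.adjoin k (Set.range w) := fun y => by
      rw [Algebra.adjoin_range_eq_range_aeval]; exact ⟨y, rfl⟩
    refine ⟨P.map ((MvPolynomial.aeval w).codRestrict _ hmem).toRingHom, hP.map _, ?_⟩
    rw [Polynomial.eval₂_map]
    exact hPx
  have halg : Algebra.IsAlgebraic (Algebra.adjoin k (Set.range w)) (MvPolynomial σ k) :=
    Algebra.IsIntegral.isAlgebraic
  have := Algebra.IsAlgebraic.isTranscendenceBasis_of_lift_le_trdeg_of_finite k w (by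
    rw [MvPolynomial.trdeg_of_isDomain, ← Nat.cast_card (α := ι), ← Nat.cast_card (α := σ), hcard]
    simp)
  exact this.1

theorem MvPolynomial.exists_point_of_isIntegral {k σ A : Type*} [Field k] [IsAlgClosed k] [Finite σ]
    [CommRing A] [IsDomain A] [IsIntegrallyClosed A] {φ : A →+* MvPolynomial σ k}
    (hφ : φ.IsIntegral) (hinj : Function.Injective φ) (f : MvPolynomial σ k) :
    ∃ P : Polynomial A, P.Monic ∧ P.eval₂ φ f = 0 ∧
      ∀ (χ : A →+* k) (_ : ∀ c : k, ∃ y, φ y = MvPolynomial.C c ∧ χ y = c) (ρ : k),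
        P.eval₂ χ ρ = 0 → ∃ a : σ → k, (∀ y, MvPolynomial.eval a (φ y) = χ y) ∧
          MvPolynomial.eval a f = ρ := by
  let _ : Algebra A (MvPolynomial σ k) := φ.toAlgebra
  have hf : IsIntegral A f := hφ f
  have : Module.IsTorsionFree A (MvPolynomial σ k) := by
    have : FaithfulSMul A (MvPolynomial σ k) := (faithfulSMul_iff_algebraMap_injective _ _).2 hinj
    infer_instance
  refine ⟨minpoly A f, minpoly.monic hf, minpoly.aeval A f, fun χ hχ ρ hρ => ?_⟩
  let ψ : Polynomial A →+* MvPolynomial σ k := (Polynomial.aeval f).toRingHom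
  let θ : Polynomial A →+* k := Polynomial.eval₂RingHom χ ρ
  have hθ : Function.Surjective θ := fun c => by
    obtain ⟨y, -, hy⟩ := hχ c
    exact ⟨Polynomial.C y, by simp [θ, hy]⟩
  let _ : Algebra (Polynomial A) (MvPolynomial σ k) := ψ.toAlgebra
  have hψ : Algebra.IsIntegral (Polynomial A) (MvPolynomial σ k) := by
    refine ⟨fun x => ?_⟩
    obtain ⟨P, hP, hPx⟩ := hφ x
    refine ⟨P.map Polynomial.C, hP.map _, ?_⟩
    rw [Polynomial.eval₂_map]
    have : (algebraMap (Polynomial A) (MvPolynomial σ k)).comp Polynomial.C = φ := by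
      refine RingHom.ext fun y => ?_
      exact Polynomial.aeval_C f y
    rw [this]
    exact hPx
  have hmax : (RingHom.ker θ).IsMaximal := RingHom.ker_isMaximal_of_surjective θ hθ
  obtain ⟨Q, hQ, hQθ⟩ := Ideal.exists_ideal_over_maximal_of_isIntegral
    (S := MvPolynomial σ k) (RingHom.ker θ) (by
      have h1 : RingHom.ker (algebraMap (Polynomial A) (MvPolynomial σ k)) =
        Ideal.span {minpoly A f} := minpoly.ker_eval hf
      rw [h1, Ideal.span_singleton_le_iff_mem]
      exact hρ)
  obtain ⟨a, ha⟩ := MvPolynomial.isMaximal_iff_eq_vanishingIdeal_singleton.1 hQ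
  have hmem : ∀ g : Polynomial A, θ g = 0 → MvPolynomial.eval a (ψ g) = 0 := by
    intro g hg
    have h1 : g ∈ Q.comap (algebraMap (Polynomial A) (MvPolynomial σ k)) := by
      rw [hQθ]; exact hg
    rw [ha, Ideal.mem_comap, MvPolynomial.mem_vanishingIdeal_singleton_iff] at h1
    rwa [MvPolynomial.aeval_eq_eval] at h1
  refine ⟨a, fun y => ?_, ?_⟩
  · obtain ⟨y', hy', hχy'⟩ := hχ (χ y)
    have h2 := hmem (Polynomial.C (y - y')) (by simp [θ, hχy'])
    have h3 : ψ (Polynomial.C (y - y')) = φ (y - y') := Polynomial.aeval_C f _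
    rw [h3, map_sub, map_sub, hy', MvPolynomial.eval_C, sub_eq_zero] at h2
    exact h2
  · obtain ⟨y', hy', hχy'⟩ := hχ ρ
    have h2 := hmem (Polynomial.X - Polynomial.C y') (by simp [θ, hχy'])
    have h3 : ψ (Polynomial.X - Polynomial.C y') = f - φ y' := by
      have h4 : ψ (Polynomial.C y') = φ y' := Polynomial.aeval_C f _
      rw [map_sub, h4]
      simp [ψ]
    rw [h3, map_sub, hy', MvPolynomial.eval_C, sub_eq_zero] at h2
    exact h2

theorem Finset.sum_range_card_le_sum (s : Finset ℕ) :
    ∑ i ∈ Finset.range s.card, i ≤ ∑ i ∈ s, i := by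
  induction s using Finset.induction_on_max with
  | empty => simp
  | insert a s ha ih =>
    have has : a ∉ s := fun h => lt_irrefl _ (ha a h)
    have hcard : s.card ≤ a := by
      have : s ⊆ Finset.range a := fun x hx => Finset.mem_range.2 (ha x hx)
      simpa using Finset.card_le_card this
    rw [Finset.card_insert_of_notMem has, Finset.sum_range_succ, Finset.sum_insert has]
    omega

theorem natDegree_wronskianMinor_le_mul {K : Type*} [Field K] [CharZero K] {n m : ℕ}
    {p : Fin n → Polynomial K} (hp : LinearIndependent K p)
    (hdeg : ∀ j, p j ∈ Polynomial.degreeLT K (n + m)) :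
    (wronskianMinor p fun i => i).natDegree ≤ n * m := by
  obtain ⟨q, hspan, hq0, hqinj⟩ := exists_span_eq_injective_natDegree hp
  obtain ⟨hWq, hsum⟩ := natDegree_wronskianMinor hq0 hqinj
  obtain ⟨c, hc⟩ := exists_matrix_of_span_eq hspan
  have hWpq := wronskianMinor_sum_smul p q c hc (fun i => i)
  have hcdet : c.det ≠ 0 := by
    intro h
    apply hWq
    rw [hWpq, h]; simp
  rw [hWpq, Polynomial.natDegree_mul_C hcdet] at hsum
  have hlt : ∀ j, (q j).natDegree < n + m := by
    intro j
    have h1 : q j ∈ Polynomial.degreeLT K (n + m) := by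
      have h2 : Submodule.span K (Set.range p) ≤ Polynomial.degreeLT K (n + m) :=
        Submodule.span_le.2 (by rintro _ ⟨i, rfl⟩; exact hdeg i)
      exact h2 (hspan ▸ Submodule.subset_span ⟨j, rfl⟩)
    rw [Polynomial.mem_degreeLT] at h1
    exact (Polynomial.natDegree_lt_iff_degree_lt (hq0 j)).2 h1
  set s : Finset ℕ := Finset.univ.image fun j => n + m - 1 - (q j).natDegree with hs
  have hinj : Function.Injective fun j => n + m - 1 - (q j).natDegree := fun i j hij => by
    have h1 := hlt i
    have h2 := hlt j
    exact hqinj (by simp only at hij ⊢; omega)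
  have hcard : s.card = n := by
    rw [hs, Finset.card_image_of_injective _ hinj, Finset.card_univ, Fintype.card_fin]
  have h1 := Finset.sum_range_card_le_sum s
  rw [hcard, hs, Finset.sum_image fun i _ j _ h => hinj h] at h1
  have h2 : ∑ j, (n + m - 1 - (q j).natDegree) + ∑ j, (q j).natDegree = n * (n + m - 1) := by
    rw [← Finset.sum_add_distrib, Finset.sum_congr rfl fun j _ =>
      show n + m - 1 - (q j).natDegree + (q j).natDegree = n + m - 1 by have := hlt j; omega]
    simp
  have h3 := Finset.sum_range_id_mul_two n
  rw [Fin.sum_univ_eq_sum_range (fun i => i) n] at hsum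
  rcases Nat.eq_zero_or_pos n with rfl | hn
  · simpa using hsum
  · have h4 : n * (n + m - 1) = n * (n - 1) + n * m := by
      rw [← mul_add]; congr 1; omega
    omega

theorem echelonFamily_mem_degreeLT {R : Type*} [CommRing R] {n m : ℕ} (x : Fin n × Fin m → R)
    (j : Fin n) : echelonFamily x j ∈ Polynomial.degreeLT R (n + m) := by
  rw [Polynomial.mem_degreeLT, Polynomial.degree_lt_iff_coeff_zero]
  exact fun e he => coeff_echelonFamily_of_le x j he

theorem linearIndependent_echelonFamily {K : Type*} [Field K] {n m : ℕ}
    (x : Fin n × Fin m → K) : LinearIndependent K (echelonFamily x) := by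
  rw [Fintype.linearIndependent_iff]
  intro g hg i
  have h := congrArg (fun f => Polynomial.coeff f i) hg
  simpa [Polynomial.finsetSum_coeff, coeff_echelonFamily_castAdd] using h

theorem natDegree_wronskianMinor_echelonFamily_le {K : Type*} [Field K] [CharZero K] {n m : ℕ}
    (x : Fin n × Fin m → K) : (wronskianMinor (echelonFamily x) fun i => i).natDegree ≤ n * m :=
  natDegree_wronskianMinor_le_mul (linearIndependent_echelonFamily x) (echelonFamily_mem_degreeLT x)

theorem coeff_wronskianMinor_echelonFamily_X {K : Type*} [Field K] {n m : ℕ}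
    (x : Fin n × Fin m → K) (e : ℕ) :
    MvPolynomial.eval x ((wronskianMinor (echelonFamily
      (MvPolynomial.X : Fin n × Fin m → MvPolynomial _ K)) fun i => i).coeff e) =
      (wronskianMinor (echelonFamily x) fun i => i).coeff e := by
  rw [← Polynomial.coeff_map, map_wronskianMinor]
  simp only [map_echelonFamily, MvPolynomial.eval_X]

theorem isIntegralElem_of_forall_valuationSubring {A B F : Type*} [CommRing A] [CommRing B]
    [Field F] {φ : A →+* B} {ι : B →+* F} (hι : Function.Injective ι) {b : B}
    (h : ∀ V : ValuationSubring F, (∀ a, ι (φ a) ∈ V) → ι b ∈ V) : φ.IsIntegralElem b := by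
  let _ : Algebra A B := φ.toAlgebra
  let _ : Algebra B F := ι.toAlgebra
  let _ : Algebra A F := (ι.comp φ).toAlgebra
  have : IsScalarTower A B F := IsScalarTower.of_algebraMap_eq fun _ => rfl
  change IsIntegral A b
  rw [← isIntegral_algebraMap_iff (show Function.Injective (algebraMap B F) from hι)]
  let R : Subring F := (integralClosure A F).toSubring
  have : IsIntegrallyClosedIn R F :=
    inferInstanceAs (IsIntegrallyClosedIn (integralClosure A F) F)
  change ι b ∈ R
  rw [Subring.eq_iInf_of_isIntegrallyClosedIn (R := R), Subring.mem_iInf]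
  rintro ⟨V, hV⟩
  exact h V fun a => hV (show _ ∈ integralClosure A F from (integralClosure A F).algebraMap_mem a)

theorem isIntegral_wronskian_coeff {K : Type*} [Field K] [CharZero K] (n m : ℕ) :
    (MvPolynomial.aeval (fun e : Fin (n * m) => (wronskianMinor (echelonFamily
      (MvPolynomial.X : Fin n × Fin m → MvPolynomial _ K)) fun i => i).coeff (e + 1)) :
      MvPolynomial (Fin (n * m)) K →ₐ[K] MvPolynomial (Fin n × Fin m) K).IsIntegral := by
  set W := wronskianMinor (echelonFamily
      (MvPolynomial.X : Fin n × Fin m → MvPolynomial _ K)) fun i => i with hW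
  set φ := (MvPolynomial.aeval (fun e : Fin (n * m) => W.coeff (e + 1)) :
      MvPolynomial (Fin (n * m)) K →ₐ[K] MvPolynomial (Fin n × Fin m) K)
  let ι := algebraMap (MvPolynomial (Fin n × Fin m) K)
    (FractionRing (MvPolynomial (Fin n × Fin m) K))
  have hι : Function.Injective ι := IsFractionRing.injective _ _
  have hcoeff : ∀ e, ∃ y, φ y = W.coeff e := by
    intro e
    rcases Nat.eq_zero_or_pos e with rfl | he
    · exact ⟨MvPolynomial.C (∏ i : Fin n, ((i : ℕ).factorial : K)), by
        rw [hW, coeff_zero_wronskianMinor_echelonFamily, MvPolynomial.algHom_C]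
        simp [MvPolynomial.algebraMap_eq]⟩
    · by_cases hle : e ≤ n * m
      · exact ⟨MvPolynomial.X ⟨e - 1, by omega⟩, by
          rw [MvPolynomial.aeval_X]
          simp only [Nat.sub_add_cancel he]⟩
      · refine ⟨0, ?_⟩
        rw [map_zero]
        refine MvPolynomial.funext fun x => ?_
        rw [map_zero, hW, coeff_wronskianMinor_echelonFamily_X,
          Polynomial.coeff_eq_zero_of_natDegree_lt]
        exact lt_of_le_of_lt (natDegree_wronskianMinor_echelonFamily_le x) (by omega)
  have hX : ∀ jk, φ.toRingHom.IsIntegralElem (MvPolynomial.X jk) := by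
    refine fun jk => isIntegralElem_of_forall_valuationSubring hι fun V hmem => ?_
    replace hmem : ∀ y, ι (φ y) ∈ V := hmem
    have : CharZero (FractionRing (MvPolynomial (Fin n × Fin m) K)) :=
      charZero_of_injective_algebraMap hι
    refine mem_valuationSubring_of_coeff_wronskianMinor_mem (V := V)
      (x := fun i => ι (MvPolynomial.X i)) ?_ ?_ jk
    · intro k hk
      have h1 := hmem (MvPolynomial.C ((k : K)⁻¹))
      convert h1 using 1
      refine inv_eq_of_mul_eq_one_left ?_
      have h2 : (k : FractionRing (MvPolynomial (Fin n × Fin m) K)) = ι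
          (φ (MvPolynomial.C (k : K))) := by simp
      rw [h2, ← map_mul, ← map_mul, ← map_mul, inv_mul_cancel₀ (Nat.cast_ne_zero.2 hk)]
      simp
    · intro e
      obtain ⟨y, hy⟩ := hcoeff e
      have h1 := hmem y
      rw [hy, ← Polynomial.coeff_map, hW, map_wronskianMinor] at h1
      simpa only [map_echelonFamily] using h1
  intro f
  induction f using MvPolynomial.induction_on with
  | C c =>
    rw [show MvPolynomial.C c = φ.toRingHom (MvPolynomial.C c) from
      (MvPolynomial.algHom_C φ c).symm]
    exact φ.toRingHom.isIntegralElem_map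
  | add f g hf hg => exact hf.add φ.toRingHom hg
  | mul_X f i hf => exact hf.mul φ.toRingHom (hX i)

theorem im_eq_zero_of_wronskianMinor_echelonFamily_simple_roots {n m : ℕ} {x : Fin n × Fin m → ℂ}
    {ι : Type*} [Fintype ι] {z : ι → ℂ} (hz : Function.Injective z) (hzr : ∀ i, (z i).im = 0)
    {a : ℂ} (ha : a ≠ 0) (hW : (wronskianMinor (echelonFamily x) fun i => i) =
      Polynomial.C a * ∏ i, (Polynomial.X - Polynomial.C (z i))) (jk : Fin n × Fin m) :
    (x jk).im = 0 := by
  obtain ⟨j, k⟩ := jk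
  obtain ⟨c, hc⟩ := (Submodule.mem_span_range_iff_exists_fun ℂ).1
    (polyConj_mem_span_of_simple_roots hz hzr ha hW j)
  have hcc : ∀ i, c i = if i = j then 1 else 0 := by
    intro i
    have h := congrArg (fun f => Polynomial.coeff f i) hc
    simpa [Polynomial.finsetSum_coeff, coeff_echelonFamily_castAdd, apply_ite] using h
  have h := congrArg (fun f => Polynomial.coeff f (n + k)) hc
  simp only [hcc, ite_smul, one_smul, zero_smul, Finset.sum_ite_eq', Finset.mem_univ, if_true,
    coeff_echelonFamily_natAdd, Polynomial.coe_mapRingHom, Polynomial.coeff_map] at h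
  exact Complex.conj_eq_iff_im.1 h.symm

theorem im_eq_zero_of_wronskianMinor_echelonFamily_eq_prod {n m : ℕ} {x : Fin n × Fin m → ℂ}
    {ι : Type*} [Fintype ι] {s : ι → ℝ} (hs : Function.Injective s) (hs0 : ∀ i, s i ≠ 0)
    {c : ℂ} (hc : c ≠ 0) (hW : (wronskianMinor (echelonFamily x) fun i => i) =
      Polynomial.C c * ∏ i, (1 - Polynomial.C (s i : ℂ) * Polynomial.X)) (jk : Fin n × Fin m) :
    (x jk).im = 0 := by
  refine im_eq_zero_of_wronskianMinor_echelonFamily_simple_roots (z := fun i => ((s i)⁻¹ : ℝ))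
    (a := c * ∏ i, (-(s i : ℂ))) ?_ ?_ ?_ ?_ jk
  · intro i j hij
    exact hs (inv_injective (Complex.ofReal_injective hij))
  · exact fun i => Complex.ofReal_im _
  · exact mul_ne_zero hc (Finset.prod_ne_zero_iff.2 fun i _ =>
      neg_ne_zero.2 (Complex.ofReal_ne_zero.2 (hs0 i)))
  · rw [hW, Polynomial.C_mul, mul_assoc, map_prod, ← Finset.prod_mul_distrib]
    congr 1
    refine Finset.prod_congr rfl fun i _ => ?_
    rw [mul_sub, ← Polynomial.C_mul, Complex.ofReal_inv, neg_mul,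
      mul_inv_cancel₀ (Complex.ofReal_ne_zero.2 (hs0 i))]
    simp
    ring

theorem exists_eq_prod_one_sub_of_real_roots (N : ℕ) {f : Polynomial ℂ} (hdeg : f.natDegree ≤ N)
    (hf0 : f.coeff 0 ≠ 0) (hroots : ∀ z, f.IsRoot z → z.im = 0) :
    ∃ s : Fin N → ℝ, f = Polynomial.C (f.coeff 0) *
      ∏ i, (1 - Polynomial.C (s i : ℂ) * Polynomial.X) := by
  induction N generalizing f with
  | zero => exact ⟨fun _ => 0, by
      simpa using Polynomial.eq_C_of_natDegree_le_zero hdeg⟩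
  | succ N ih =>
    by_cases hd : f.natDegree = 0
    · exact ⟨fun _ => 0, by simpa using Polynomial.eq_C_of_natDegree_eq_zero hd⟩
    · have hne : f ≠ 0 := by rintro rfl; simp at hf0
      obtain ⟨r, hr⟩ := IsAlgClosed.exists_root f (by
        rwa [Ne, Polynomial.degree_eq_natDegree hne, Nat.cast_eq_zero])
      obtain ⟨g, hg⟩ := Polynomial.dvd_iff_isRoot.2 hr
      have hr0 : r ≠ 0 := by
        rintro rfl
        rw [hg] at hf0
        simp at hf0
      have hrr : ((r.re : ℝ) : ℂ) = r := Complex.conj_eq_iff_re.1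
        (Complex.conj_eq_iff_im.2 (hroots r hr))
      have hg0 : g ≠ 0 := by rintro rfl; simp [hg] at hne
      have hfg : f = (1 - Polynomial.C r⁻¹ * Polynomial.X) * (Polynomial.C (-r) * g) := by
        have : (1 : Polynomial ℂ) = Polynomial.C r⁻¹ * Polynomial.C r := by
          rw [← Polynomial.C_mul, inv_mul_cancel₀ hr0, Polynomial.C_1]
        rw [hg, Polynomial.C_neg]
        linear_combination Polynomial.X * g * this
      have hcoeff : (Polynomial.C (-r) * g).coeff 0 = f.coeff 0 := by
        rw [hfg]
        simp [Polynomial.mul_coeff_zero]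
      have hdeg' : (Polynomial.C (-r) * g).natDegree ≤ N := by
        rw [Polynomial.natDegree_C_mul (neg_ne_zero.2 hr0)]
        rw [hg, Polynomial.natDegree_mul (Polynomial.X_sub_C_ne_zero r) hg0,
          Polynomial.natDegree_X_sub_C] at hdeg
        omega
      obtain ⟨s, hs⟩ := ih hdeg' (by rwa [hcoeff]) fun z hz => hroots z (by
        rw [hfg]
        exact Polynomial.root_mul_left_of_isRoot _ hz)
      refine ⟨Fin.cons (r.re)⁻¹ s, ?_⟩
      rw [Fin.prod_univ_succ]
      simp only [Fin.cons_zero, Fin.cons_succ]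
      rw [Complex.ofReal_inv, hrr, mul_left_comm, ← hcoeff, ← hs]
      exact hfg

theorem continuous_coeff_prod {T ι : Type*} [TopologicalSpace T] (S : Finset ι)
    {f : ι → T → Polynomial ℂ} (hf : ∀ i e, Continuous fun t => (f i t).coeff e) (e : ℕ) :
    Continuous fun t => (∏ i ∈ S, f i t).coeff e := by
  classical
  induction S using Finset.induction_on generalizing e with
  | empty => simpa using continuous_const
  | insert i S hi ih =>
    simp only [Finset.prod_insert hi, Polynomial.coeff_mul]
    exact continuous_finsetSum _ fun _ _ => (hf _ _).mul (ih _)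

theorem abs_im_pow_le_norm_eval {P : Polynomial ℂ} (hP : P.Monic)
    (hroots : ∀ z, P.IsRoot z → z.im = 0) (ρ : ℂ) : |ρ.im| ^ P.natDegree ≤ ‖P.eval ρ‖ := by
  have hsplit := IsAlgClosed.splits P
  have hcard : P.roots.card = P.natDegree := hsplit.natDegree_eq_card_roots.symm
  have h1 : P.eval ρ = (P.roots.map fun r => ρ - r).prod := by
    conv_lhs => rw [hsplit.eq_prod_roots_of_monic hP]
    rw [Polynomial.eval_multiset_prod, Multiset.map_map]
    simp
  rw [h1, ← hcard, ← Multiset.prod_replicate, ← Multiset.map_const']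
  have h2 : ‖(P.roots.map fun r => ρ - r).prod‖ = (P.roots.map fun r => ‖ρ - r‖).prod := by
    simpa using map_multiset_prod (normHom : ℂ →*₀ ℝ) (P.roots.map fun r => ρ - r)
  rw [h2]
  refine Multiset.prod_map_le_prod_map₀ _ _ (fun _ _ => abs_nonneg _) fun r hr => ?_
  have h3 := Complex.abs_im_le_norm (ρ - r)
  rwa [Complex.sub_im, hroots r (Polynomial.isRoot_of_mem_roots hr), sub_zero] at h3

open Filter Topology in
theorem eventually_add_mul_ne_zero (a : ℝ) {b : ℝ} (hb : b ≠ 0) :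
    ∀ᶠ ε in 𝓝[≠] (0 : ℝ), a + ε * b ≠ 0 := by
  by_cases ha : a = 0
  · filter_upwards [self_mem_nhdsWithin] with ε hε
    rw [ha, zero_add]
    exact mul_ne_zero hε hb
  · have : Tendsto (fun ε : ℝ => a + ε * b) (𝓝[≠] 0) (𝓝 a) := by
      have h : Continuous fun ε : ℝ => a + ε * b := by fun_prop
      simpa using (h.tendsto 0).mono_left nhdsWithin_le_nhds
    exact this.eventually_ne ha

open Filter Topology in
theorem im_eq_zero_of_wronskianMinor_echelonFamily_real_roots {n m : ℕ} {x : Fin n × Fin m → ℂ}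
    (hroots : ∀ z, (wronskianMinor (echelonFamily x) fun i => i).IsRoot z → z.im = 0)
    (jk : Fin n × Fin m) : (x jk).im = 0 := by
  set c : ℂ := ∏ i : Fin n, ((i : ℕ).factorial : ℂ) with hcdef
  have hc : c ≠ 0 := Finset.prod_ne_zero_iff.2 fun i _ =>
    Nat.cast_ne_zero.2 (Nat.factorial_ne_zero _)
  have hc0 : ∀ y : Fin n × Fin m → ℂ, (wronskianMinor (echelonFamily y) fun i => i).coeff 0 = c :=
    coeff_zero_wronskianMinor_echelonFamily
  obtain ⟨s, hs⟩ := exists_eq_prod_one_sub_of_real_roots (n * m)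
    (natDegree_wronskianMinor_echelonFamily_le x) (by rw [hc0]; exact hc) hroots
  rw [hc0] at hs
  let G : ℝ → Polynomial ℂ := fun ε => Polynomial.C c *
    ∏ i : Fin (n * m), (1 - Polynomial.C ((s i + ε * ((i : ℕ) + 1 : ℕ) : ℝ) : ℂ) * Polynomial.X)
  have hG0 : G 0 = wronskianMinor (echelonFamily x) fun i => i := by
    rw [hs]; simp [G]
  have hGdeg : ∀ ε, (G ε).natDegree ≤ n * m := by
    intro ε
    refine (Polynomial.natDegree_C_mul_le _ _).trans ((Polynomial.natDegree_prod_le _ _).trans ?_)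
    refine (Finset.sum_le_card_nsmul _ _ 1 fun i _ => ?_).trans (by simp)
    compute_degree
  have hGc : ∀ ε, (G ε).coeff 0 = c := by
    intro ε
    simp [G, Polynomial.mul_coeff_zero, Polynomial.coeff_zero_prod]
  have hGcont : ∀ e, Continuous fun ε => (G ε).coeff e := by
    intro e
    simp only [G, Polynomial.coeff_C_mul]
    refine continuous_const.mul (continuous_coeff_prod _ (fun i e => ?_) e)
    simp only [Polynomial.coeff_sub, Polynomial.coeff_C_mul]
    fun_prop
  set w : Fin (n * m) → MvPolynomial (Fin n × Fin m) ℂ := fun e => (wronskianMinor (echelonFamily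
      (MvPolynomial.X : Fin n × Fin m → MvPolynomial _ ℂ)) fun i => i).coeff (e + 1) with hw
  have hint := isIntegral_wronskian_coeff (K := ℂ) n m
  have hinj := MvPolynomial.aeval_injective_of_isIntegral (w := w) (by simp) hint
  obtain ⟨P, hP, hPf, hpoint⟩ := MvPolynomial.exists_point_of_isIntegral
    (φ := (MvPolynomial.aeval w : MvPolynomial (Fin (n * m)) ℂ →ₐ[ℂ]
      MvPolynomial (Fin n × Fin m) ℂ).toRingHom) hint hinj (MvPolynomial.X jk)
  let χ : ℝ → MvPolynomial (Fin (n * m)) ℂ →+* ℂ := fun ε =>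
    MvPolynomial.eval fun e => (G ε).coeff (e + 1)
  have hreal : ∀ᶠ ε in 𝓝[≠] (0 : ℝ), ∀ z, (P.map (χ ε)).IsRoot z → z.im = 0 := by
    have h1 : ∀ᶠ ε in 𝓝[≠] (0 : ℝ), ∀ i : Fin (n * m), s i + ε * ((i : ℕ) + 1 : ℕ) ≠ 0 :=
      eventually_all.2 fun i => eventually_add_mul_ne_zero _ (by positivity)
    have h2 : ∀ᶠ ε in 𝓝[≠] (0 : ℝ), ∀ i j : Fin (n * m), i ≠ j →
        (s i - s j) + ε * ((i : ℝ) - (j : ℝ)) ≠ 0 := by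
      refine eventually_all.2 fun i => eventually_all.2 fun j => ?_
      by_cases hij : i = j
      · exact Eventually.of_forall fun _ h => absurd hij h
      · filter_upwards [eventually_add_mul_ne_zero (s i - s j) (b := (i : ℝ) - (j : ℝ))
          (sub_ne_zero.2 fun h => hij (Fin.ext (by exact_mod_cast h)))] with ε hε _ using hε
    filter_upwards [h1, h2] with ε hε1 hε2 z hz
    rw [Polynomial.IsRoot, Polynomial.eval_map] at hz
    obtain ⟨a, ha, haz⟩ := hpoint (χ ε) (fun c => ⟨MvPolynomial.C c, by
      exact MvPolynomial.algHom_C _ c, by simp [χ]⟩) z hz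
    rw [MvPolynomial.eval_X] at haz
    rw [← haz]
    refine im_eq_zero_of_wronskianMinor_echelonFamily_eq_prod (c := c)
      (s := fun i : Fin (n * m) => s i + ε * ((i : ℕ) + 1 : ℕ)) (fun i j hij => ?_) hε1 hc ?_ jk
    · by_contra h
      refine hε2 i j h ?_
      push_cast at hij
      linear_combination hij
    · change _ = G ε
      refine Polynomial.ext fun e => ?_
      rcases Nat.eq_zero_or_pos e with rfl | he
      · rw [hc0, hGc]
      · by_cases hle : e ≤ n * m
        · have h3 := ha (MvPolynomial.X ⟨e - 1, by omega⟩)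
          have h4 : MvPolynomial.aeval w (MvPolynomial.X ⟨e - 1, by omega⟩ :
            MvPolynomial (Fin (n * m)) ℂ) = w ⟨e - 1, by omega⟩ := MvPolynomial.aeval_X _ _
          change MvPolynomial.eval a (MvPolynomial.aeval w _) = _ at h3
          rw [h4, hw] at h3
          simp only [χ, MvPolynomial.eval_X, Nat.sub_add_cancel he,
            coeff_wronskianMinor_echelonFamily_X] at h3
          exact h3
        · rw [Polynomial.coeff_eq_zero_of_natDegree_lt, Polynomial.coeff_eq_zero_of_natDegree_lt]
          · exact (hGdeg ε).trans_lt (by omega)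
          · exact (natDegree_wronskianMinor_echelonFamily_le a).trans_lt (by omega)
  have hzero : P.eval₂ (χ 0) (x jk) = 0 := by
    have h := congrArg (MvPolynomial.eval x) hPf
    rw [Polynomial.hom_eval₂, map_zero, MvPolynomial.eval_X] at h
    refine Eq.trans ?_ h
    congr 1
    refine MvPolynomial.ringHom_ext (fun r => ?_) fun e => ?_
    · simp [χ]
    · simp [χ, hw, coeff_wronskianMinor_echelonFamily_X, hG0]
  have hcont : Continuous fun ε => ‖P.eval₂ (χ ε) (x jk)‖ := by
    refine Continuous.norm ?_
    simp only [Polynomial.eval₂_eq_sum, Polynomial.sum]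
    refine continuous_finsetSum _ fun e _ => Continuous.mul ?_ continuous_const
    exact (MvPolynomial.continuous_eval (P.coeff e)).comp (continuous_pi fun i => hGcont _)
  have hle : |(x jk).im| ^ P.natDegree ≤ ‖P.eval₂ (χ 0) (x jk)‖ := by
    refine ge_of_tendsto (((hcont.tendsto 0).mono_left nhdsWithin_le_nhds :
      Tendsto _ (𝓝[≠] (0 : ℝ)) _)) ?_
    filter_upwards [hreal] with ε hε
    have h := abs_im_pow_le_norm_eval (hP.map (χ ε)) hε (x jk)
    rwa [hP.natDegree_map, Polynomial.eval_map] at h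
  rw [hzero, norm_zero] at hle
  exact abs_eq_zero.1 (eq_zero_of_pow_eq_zero (le_antisymm hle (by positivity)))

theorem wronskianMinor_taylor {R : Type*} [CommRing R] {n : ℕ} (t : R) (p : Fin n → Polynomial R)
    (r : Fin n → ℕ) :
    wronskianMinor (fun j => Polynomial.taylor t (p j)) r =
      Polynomial.taylor t (wronskianMinor p r) := by
  have h : ∀ (k : ℕ) (f : Polynomial R), Polynomial.derivative^[k] (Polynomial.taylor t f) =
      Polynomial.taylor t (Polynomial.derivative^[k] f) := by
    intro k f
    induction k generalizing f with
    | zero => rfl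
    | succ k ih =>
      rw [Function.iterate_succ_apply, Function.iterate_succ_apply, ← ih]
      congr 1
      simp [Polynomial.taylor_apply, Polynomial.derivative_comp]
  have hdet := (Polynomial.taylorAlgHom t).map_det
    (Matrix.of fun i j => Polynomial.derivative^[r i] (p j))
  change Polynomial.taylor t _ = _ at hdet
  rw [wronskianMinor, wronskianMinor, hdet]
  congr 1
  exact Matrix.ext fun i j => h _ _

theorem exists_echelonFamily_span_eq {K : Type*} [Field K] {n : ℕ} {q : Fin n → Polynomial K}
    (hq : (wronskianMinor q fun i => i).coeff 0 ≠ 0) :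
    ∃ (m : ℕ) (x : Fin n × Fin m → K) (a : K), a ≠ 0 ∧
      Submodule.span K (Set.range (echelonFamily x)) = Submodule.span K (Set.range q) ∧
      (wronskianMinor (echelonFamily x) fun i => i) =
        (wronskianMinor q fun i => i) * Polynomial.C a := by
  set M : Matrix (Fin n) (Fin n) K := Matrix.of fun i j => (q j).coeff i with hM
  have hMdet : M.det ≠ 0 := by
    rw [coeff_zero_wronskianMinor] at hq
    exact right_ne_zero_of_mul hq
  have hunit : IsUnit M.det := hMdet.isUnit
  let m := Finset.univ.sup (fun j => (q j).natDegree) + 1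
  let q' : Fin n → Polynomial K := fun j => ∑ i, M⁻¹ i j • q i
  let x : Fin n × Fin m → K := fun jk => (q' jk.1).coeff (n + jk.2)
  have hx : ∀ j, echelonFamily x j = q' j := by
    intro j
    refine Polynomial.ext fun e => ?_
    rcases lt_or_ge e n with he | he
    · rw [show e = ((⟨e, he⟩ : Fin n) : ℕ) from rfl, coeff_echelonFamily_castAdd]
      have h1 := congrFun (congrFun (Matrix.mul_nonsing_inv M hunit) ⟨e, he⟩) j
      rw [Matrix.mul_apply, Matrix.one_apply] at h1
      rw [← h1]
      simp [q', hM, Polynomial.finsetSum_coeff, mul_comm]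
    · rcases lt_or_ge e (n + m) with he' | he'
      · obtain ⟨k, rfl⟩ := Nat.exists_eq_add_of_le he
        exact coeff_echelonFamily_natAdd x j ⟨k, by omega⟩
      · rw [coeff_echelonFamily_of_le x j he']
        simp only [q', Polynomial.finsetSum_coeff, Polynomial.coeff_smul]
        refine (Finset.sum_eq_zero fun i _ => ?_).symm
        rw [Polynomial.coeff_eq_zero_of_natDegree_lt, smul_zero]
        have : (q i).natDegree ≤ Finset.univ.sup (fun j => (q j).natDegree) :=
          Finset.le_sup (f := fun j => (q j).natDegree) (Finset.mem_univ i)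
        omega
  refine ⟨m, x, M⁻¹.det, ?_, le_antisymm (Submodule.span_le.2 ?_) (Submodule.span_le.2 ?_),
    wronskianMinor_sum_smul _ _ _ hx _⟩
  · rw [Matrix.det_nonsing_inv, Ring.inverse_eq_inv']
    exact inv_ne_zero hMdet
  · rintro _ ⟨j, rfl⟩
    rw [hx]
    exact Submodule.sum_mem _ fun i _ => Submodule.smul_mem _ _ (Submodule.subset_span ⟨i, rfl⟩)
  · rintro _ ⟨j, rfl⟩
    have h1 : q j = ∑ i, M i j • echelonFamily x i := by
      simp only [hx, q', Finset.smul_sum, smul_smul]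
      rw [Finset.sum_comm]
      simp only [← Finset.sum_smul]
      have h2 : ∀ l, ∑ i, M i j * M⁻¹ l i = (1 : Matrix (Fin n) (Fin n) K) l j := fun l => by
        rw [← Matrix.nonsing_inv_mul M hunit, Matrix.mul_apply]
        exact Finset.sum_congr rfl fun i _ => mul_comm _ _
      simp [h2, Matrix.one_apply]
    rw [h1]
    exact Submodule.sum_mem _ fun i _ => Submodule.smul_mem _ _ (Submodule.subset_span ⟨i, rfl⟩)

theorem exists_real_eval_ne_zero {f : Polynomial ℂ} (hf : f ≠ 0) : ∃ t : ℝ, f.eval (t : ℂ) ≠ 0 := by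
  by_contra! h
  refine hf (Polynomial.eq_zero_of_infinite_isRoot f
    ((Set.infinite_range_of_injective Complex.ofReal_injective).mono ?_))
  rintro _ ⟨t, rfl⟩
  exact h t

/-- **the Shapiro Conjecture for Grassmannians.** If the Wronskian of
`p₁, …, pₙ ∈ ℂ[x]` is a nonzero polynomial all of whose complex roots are real, then the
`ℂ`-linear span of `{p₁, …, pₙ}` is spanned by polynomials with real coefficients. -/
theorem shapiro_conjecture (n : ℕ) (p : Fin n → Polynomial ℂ) (W : Polynomial ℂ)
    (hW : W = (Matrix.of fun i j : Fin n =>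
      (fun q : Polynomial ℂ => Polynomial.derivative q)^[(i : ℕ)] (p j)).det)
    (hW0 : W ≠ 0)
    (hroots : ∀ z : ℂ, W.IsRoot z → z.im = 0) :
    ∃ S : Set (Polynomial ℂ),
      (∀ q ∈ S, ∀ k, (q.coeff k).im = 0) ∧
      Submodule.span ℂ S = Submodule.span ℂ (Set.range p) := by
  replace hW : W = wronskianMinor p fun i => i := hW
  obtain ⟨t, ht⟩ := exists_real_eval_ne_zero hW0
  have hWt := wronskianMinor_taylor (t : ℂ) p fun i => i
  rw [← hW] at hWt
  obtain ⟨m, x, a, ha, hspan, hWx⟩ := exists_echelonFamily_span_eq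
    (q := fun j => Polynomial.taylor (t : ℂ) (p j))
    (by rwa [hWt, Polynomial.taylor_coeff_zero])
  have hx : ∀ jk, (x jk).im = 0 := im_eq_zero_of_wronskianMinor_echelonFamily_real_roots
    fun z hz => by
      rw [hWx, hWt, Polynomial.IsRoot, Polynomial.eval_mul, Polynomial.eval_C, mul_eq_zero,
        or_iff_left ha, Polynomial.taylor_eval] at hz
      simpa using hroots _ hz
  have hconj : ∀ j, (echelonFamily x j).map (starRingEnd ℂ) = echelonFamily x j := fun j => by
    rw [map_echelonFamily]
    congr 1
    exact funext fun jk => Complex.conj_eq_iff_im.2 (hx jk)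
  refine ⟨Set.range fun j => Polynomial.taylor (-t : ℂ) (echelonFamily x j), ?_, ?_⟩
  · rintro _ ⟨j, rfl⟩ k
    refine Complex.conj_eq_iff_im.1 ?_
    rw [← Polynomial.coeff_map, Polynomial.map_taylor, hconj, map_neg, Complex.conj_ofReal]
  · have h := congrArg (Submodule.map (Polynomial.taylor (-t : ℂ))) hspan
    rw [Submodule.map_span, Submodule.map_span, ← Set.range_comp, ← Set.range_comp] at h
    refine h.trans ?_
    congr 2
    exact funext fun j => by simp [Polynomial.taylor_taylor]
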